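/- Assume BH(s,r) holds for some 3/2 < s < 2 and r < s'. Then there is a constant C (depending only on s, r and the constant in BH(s,r)) such that for every Lebesgue-measurable set Ω ⊆ ℝ² of finite measure, ∥𝓔χ_Ω∥_{L^{2s}(ℝ³)} ≤ C |Ω|^{1/s'}; i.e., 𝓔 is of restricted strong type (s', 2s). -/

import Mathlib

open MeasureTheory Set

/-- The extension operator for the hyperbolic paraboloid `τ = ξ₁ξ₂` in `ℝ³`:
`𝓔f(t,x) = ∫_{ℝ²} e^{i(tξ₁ξ₂ + x·ξ)} f(ξ) dξ`. -/
noncomputable def extOp (f : ℝ × ℝ → ℂ) (p : ℝ × ℝ × ℝ) : ℂ :=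
  ∫ ξ : ℝ × ℝ,
    Complex.exp (Complex.I * (p.1 * ξ.1 * ξ.2 + p.2.1 * ξ.1 + p.2.2 * ξ.2 : ℝ)) * f ξ

/-- Characteristic function of a set, valued in `ℂ`. -/
noncomputable def chi (Ω : Set (ℝ × ℝ)) : ℝ × ℝ → ℂ := Ω.indicator fun _ => 1

/-- The axis-parallel unit square with lower-left corner `(a, b)`. -/
def unitSq (a b : ℝ) : Set (ℝ × ℝ) := Icc a (a + 1) ×ˢ Icc b (b + 1)

/-- Bilinear hypothesis BH(s,r) with constant `A`: a bilinear adjoint restriction estimate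
`∥𝓔f·𝓔g∥_{L^s} ≤ A ∥f∥_{L^r} ∥g∥_{L^r}` whenever `f, g` are supported in `1 × 1`
axis-parallel squares whose projections onto each coordinate axis are separated by a
distance between `1` and `4` (equivalently, the corners satisfy `2 ≤ |aᵢ - bᵢ| ≤ 5`). -/
def BH (s r A : ℝ) : Prop :=
  ∀ a₁ a₂ b₁ b₂ : ℝ, 2 ≤ |a₁ - b₁| → |a₁ - b₁| ≤ 5 → 2 ≤ |a₂ - b₂| → |a₂ - b₂| ≤ 5 →
    ∀ f g : ℝ × ℝ → ℂ,
      Function.support f ⊆ unitSq a₁ a₂ → Function.support g ⊆ unitSq b₁ b₂ →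
      eLpNorm (fun p => extOp f p * extOp g p) (ENNReal.ofReal s) volume ≤
        ENNReal.ofReal A * eLpNorm f (ENNReal.ofReal r) volume *
          eLpNorm g (ENNReal.ofReal r) volume

open scoped ENNReal


/-- Finite subadditivity of concave powers. -/
lemma hp_rpow_sum_le {ι : Type*} (F : Finset ι) (f : ι → ℝ≥0∞) {q : ℝ} (h0 : 0 < q)
    (h1 : q ≤ 1) : (∑ i ∈ F, f i) ^ q ≤ ∑ i ∈ F, f i ^ q := by
  classical
  induction F using Finset.induction_on with
  | empty => simp [ENNReal.zero_rpow_of_pos h0]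
  | insert a s ha ih =>
    rw [Finset.sum_insert ha, Finset.sum_insert ha]
    exact (ENNReal.rpow_add_le_add_rpow _ _ h0.le h1).trans (by gcongr)

/-- Jensen's inequality with a weight. -/
lemma hp_jensen {α : Type*} [MeasurableSpace α] (μ : Measure α) (w f : α → ℝ≥0∞)
    (hw : Measurable w) (hf : Measurable f) {s : ℝ} (hs : 1 < s) :
    (∫⁻ x, w x * f x ∂μ) ^ s ≤ (∫⁻ x, w x ∂μ) ^ (s - 1) * ∫⁻ x, w x * f x ^ s ∂μ := by
  have hc : s.HolderConjugate (s / (s - 1)) := Real.HolderConjugate.conjExponent hs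
  have hq : 0 < s / (s - 1) := div_pos (by linarith) (by linarith)
  have hmeas : Measurable (fun x => f x ^ s) := hf.pow_const s
  have h1 := ENNReal.lintegral_mul_le_Lp_mul_Lq (μ.withDensity w) hc
    (f := f) (g := fun _ => 1) hf.aemeasurable (by fun_prop)
  simp only [Pi.mul_apply, mul_one, ENNReal.one_rpow] at h1
  rw [lintegral_withDensity_eq_lintegral_mul _ hw hf,
    lintegral_withDensity_eq_lintegral_mul _ hw hmeas,
    lintegral_withDensity_eq_lintegral_mul _ hw measurable_const] at h1
  simp only [Pi.mul_apply, mul_one] at h1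
  calc _ ≤ _ := ENNReal.rpow_le_rpow h1 (by linarith)
    _ = _ := by
      rw [ENNReal.mul_rpow_of_nonneg _ _ (by linarith), ← ENNReal.rpow_mul, ← ENNReal.rpow_mul,
        mul_comm]
      have e1 : 1 / (s / (s - 1)) * s = s - 1 := by
        have : s - 1 ≠ 0 := by linarith
        field_simp
      have e2 : 1 / s * s = 1 := by field_simp
      rw [e1, e2, ENNReal.rpow_one]

/-- Orthogonality of exponentials on `(0, 2π]`. -/
lemma hp_exp_orth (F : Finset ℤ) (c : ℤ → ℂ) :
    ∫⁻ h in Ioc 0 (2 * Real.pi),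
      ‖∑ m ∈ F, Complex.exp (-(2 * m * h : ℝ) * Complex.I) * c m‖ₑ ^ (2 : ℝ) =
    ENNReal.ofReal (2 * Real.pi) * ∑ m ∈ F, ‖c m‖ₑ ^ (2 : ℝ) := by
  have hcont : Continuous fun h : ℝ =>
      ∑ m ∈ F, Complex.exp (-(2 * m * h : ℝ) * Complex.I) * c m := by fun_prop
  have hI : ∫ h in (0 : ℝ)..(2 * Real.pi),
      (∑ m ∈ F, Complex.exp (-(2 * m * h : ℝ) * Complex.I) * c m) *
        (starRingEnd ℂ) (∑ m ∈ F, Complex.exp (-(2 * m * h : ℝ) * Complex.I) * c m) =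
      2 * Real.pi * ∑ m ∈ F, (c m * (starRingEnd ℂ) (c m)) := by
    have e1 : ∀ h : ℝ, (∑ m ∈ F, Complex.exp (-(2 * m * h : ℝ) * Complex.I) * c m) *
        (starRingEnd ℂ) (∑ m ∈ F, Complex.exp (-(2 * m * h : ℝ) * Complex.I) * c m) =
        ∑ m ∈ F, ∑ n ∈ F, (c m * (starRingEnd ℂ) (c n)) *
          Complex.exp ((2 * (n - m : ℤ) * Complex.I : ℂ) * h) := by
      intro h
      rw [map_sum, Finset.sum_mul_sum]
      refine Finset.sum_congr rfl fun m _ => Finset.sum_congr rfl fun n _ => ?_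
      rw [map_mul, ← Complex.exp_conj]
      simp only [map_mul, map_neg, Complex.conj_ofReal, Complex.conj_I]
      have : Complex.exp ((2 * (n - m : ℤ) * Complex.I : ℂ) * h) =
        Complex.exp (-((2 * m * h : ℝ) : ℂ) * Complex.I) *
          Complex.exp (-((2 * n * h : ℝ) : ℂ) * -Complex.I) := by
        rw [← Complex.exp_add]; congr 1; push_cast; ring
      rw [this]; ring
    simp_rw [e1]
    rw [intervalIntegral.integral_finsetSum
      (fun m _ => Continuous.intervalIntegrable (by fun_prop) _ _)]
    rw [Finset.mul_sum]
    refine Finset.sum_congr rfl fun m hm => ?_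
    rw [intervalIntegral.integral_finsetSum
      (fun m _ => Continuous.intervalIntegrable (by fun_prop) _ _)]
    rw [Finset.sum_eq_single m]
    · simp; ring
    · intro n _ hn
      rw [intervalIntegral.integral_const_mul, integral_exp_mul_complex]
      · have : Complex.exp (2 * (n - m : ℤ) * Complex.I * ((2 * Real.pi : ℝ) : ℂ)) = 1 := by
          rw [Complex.exp_eq_one_iff]
          exact ⟨2 * (n - m), by push_cast; ring⟩
        rw [this]; simp
      · have : ((n - m : ℤ) : ℂ) ≠ 0 := by exact_mod_cast sub_ne_zero.2 hn
        simp only [ne_eq, mul_eq_zero, not_or]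
        exact ⟨⟨by norm_num, this⟩, Complex.I_ne_zero⟩
    · intro h; exact absurd hm h
  have hI2 : ∫ h in (0 : ℝ)..(2 * Real.pi),
      ‖∑ m ∈ F, Complex.exp (-(2 * m * h : ℝ) * Complex.I) * c m‖ ^ 2 =
      2 * Real.pi * ∑ m ∈ F, ‖c m‖ ^ 2 := by
    have := hI
    simp only [Complex.mul_conj'] at this
    have h3 : ∀ h : ℝ, ((‖∑ m ∈ F, Complex.exp (-(2 * m * h : ℝ) * Complex.I) * c m‖ : ℝ) : ℂ) ^ 2
      = ((‖∑ m ∈ F, Complex.exp (-(2 * m * h : ℝ) * Complex.I) * c m‖ ^ 2 : ℝ) : ℂ) := by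
        intro h; push_cast; rfl
    simp_rw [h3] at this
    rw [intervalIntegral.integral_ofReal] at this
    exact_mod_cast this
  have key : ∀ z : ℂ, ‖z‖ₑ ^ (2 : ℝ) = ENNReal.ofReal (‖z‖ ^ 2) := by
    intro z
    rw [← ofReal_norm, ENNReal.ofReal_rpow_of_nonneg (norm_nonneg _) (by norm_num)]
    norm_num
  simp_rw [key]
  rw [← ofReal_integral_eq_lintegral_ofReal, ← intervalIntegral.integral_of_le (by positivity), hI2,
    ENNReal.ofReal_mul (by positivity), ENNReal.ofReal_sum_of_nonneg (fun i _ => by positivity)]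
  · exact (Continuous.intervalIntegrable (by fun_prop) _ _).1
  · exact Filter.Eventually.of_forall fun x => by positivity

lemma hp_exp_orth_s (F : Finset ℤ) (c : ℤ → ℂ) {s : ℝ} (hs1 : 1 < s) (hs2 : s < 2) :
    ∫⁻ h in Ioc 0 (2 * Real.pi),
      ‖∑ m ∈ F, Complex.exp (-(2 * m * h : ℝ) * Complex.I) * c m‖ₑ ^ s ≤
    ENNReal.ofReal (2 * Real.pi) * ∑ m ∈ F, ‖c m‖ₑ ^ s := by
  set f : ℝ → ℝ≥0∞ := fun h =>
    ‖∑ m ∈ F, Complex.exp (-(2 * m * h : ℝ) * Complex.I) * c m‖ₑ ^ s with hf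
  have hfm : Measurable f := by
    have : Continuous fun h : ℝ =>
      ∑ m ∈ F, Complex.exp (-(2 * m * h : ℝ) * Complex.I) * c m := by fun_prop
    exact this.measurable.enorm.pow_const s
  have h2s : 1 < 2 / s := by rw [lt_div_iff₀ (by linarith)]; linarith
  have h1 := hp_jensen (volume.restrict (Ioc 0 (2 * Real.pi))) (fun _ => 1) f measurable_const hfm h2s
  simp only [one_mul, lintegral_one, Measure.restrict_apply_univ, Real.volume_Ioc, sub_zero] at h1
  have e : ∀ h, f h ^ (2 / s) =
      ‖∑ m ∈ F, Complex.exp (-(2 * m * h : ℝ) * Complex.I) * c m‖ₑ ^ (2 : ℝ) := by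
    intro h; simp only [hf]; rw [← ENNReal.rpow_mul]; congr 1; field_simp
  simp_rw [e, hp_exp_orth] at h1
  have h2 := ENNReal.rpow_le_rpow h1 (show 0 ≤ s / 2 by linarith)
  rw [← ENNReal.rpow_mul, show 2 / s * (s / 2) = 1 by field_simp, ENNReal.rpow_one] at h2
  refine h2.trans ?_
  have hpi : ENNReal.ofReal (2 * Real.pi) ≠ 0 := by simp [Real.pi_pos]
  rw [← mul_assoc, ENNReal.mul_rpow_of_nonneg _ _ (by linarith : (0:ℝ) ≤ s / 2)]
  nth_rw 2 [← ENNReal.rpow_one (ENNReal.ofReal (2 * Real.pi))]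
  rw [← ENNReal.rpow_add _ _ hpi ENNReal.ofReal_ne_top, ← ENNReal.rpow_mul,
    show (2 / s - 1 + 1) * (s / 2) = 1 by field_simp; ring, ENNReal.rpow_one]
  gcongr
  refine (hp_rpow_sum_le F _ (by linarith) (by linarith)).trans (le_of_eq ?_)
  refine Finset.sum_congr rfl fun m _ => ?_
  rw [← ENNReal.rpow_mul]; congr 1; ring


lemma hp_kernel : ∃ k : ℝ → ℂ, Continuous k ∧ Integrable k ∧
    (∃ C : ℝ, 0 < C ∧ ∀ y, ‖k y‖ ≤ C * (1 + y ^ 2)⁻¹) ∧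
    ∀ l : ℝ, |l| ≤ 5 → ∫ y, k y * Complex.exp (-(l * y : ℝ) * Complex.I) = 1 := by
  let b : ContDiffBump (0 : ℝ) := ⟨1, 2, by norm_num, by norm_num⟩
  have h1 : HasCompactSupport (fun x => ((b x : ℝ) : ℂ)) :=
    b.hasCompactSupport.comp_left (g := fun x : ℝ => (x : ℂ)) (by simp)
  have h2 : ContDiff ℝ (⊤ : ℕ∞) (fun x => ((b x : ℝ) : ℂ)) :=
    Complex.ofRealCLM.contDiff.comp b.contDiff
  let ψ : SchwartzMap ℝ ℂ := h1.toSchwartzMap h2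
  let κ : SchwartzMap ℝ ℂ := FourierTransformInv.fourierInv ψ
  refine ⟨κ, κ.continuous, κ.integrable, ?_, ?_⟩
  · obtain ⟨C0, hC0, h0⟩ := κ.decay 0 0
    obtain ⟨C2, hC2, h2⟩ := κ.decay 2 0
    refine ⟨C0 + C2, by positivity, fun y => ?_⟩
    have a := h0 y
    have b := h2 y
    simp only [norm_iteratedFDeriv_zero, pow_zero, one_mul, Real.norm_eq_abs, sq_abs] at a b
    rw [← div_eq_mul_inv, le_div_iff₀ (by positivity)]
    linarith
  · intro l hl
    have : FourierTransform.fourier κ = ψ := FourierTransform.fourier_fourierInv_eq ψ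
    have h3 := congrArg (fun f : SchwartzMap ℝ ℂ => f (l / (2 * Real.pi))) this
    simp only [SchwartzMap.fourier_coe] at h3
    have h4 : ψ (l / (2 * Real.pi)) = 1 := by
      have : b (l / (2 * Real.pi)) = 1 := by
        apply b.one_of_mem_closedBall
        rw [Metric.mem_closedBall, dist_zero_right, Real.norm_eq_abs, abs_div,
          abs_of_pos (by positivity : 0 < 2 * Real.pi)]
        show _ ≤ (1 : ℝ)
        rw [div_le_one (by positivity)]
        linarith [Real.pi_gt_three]
      change ((b (l / (2 * Real.pi)) : ℝ) : ℂ) = 1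
      rw [this]; simp
    rw [h4, Real.fourier_eq'] at h3
    rw [← h3]
    refine integral_congr_ae (Filter.Eventually.of_forall fun y => ?_)
    simp only [smul_eq_mul]
    rw [mul_comm]
    congr 2
    simp only [RCLike.inner_apply, conj_trivial]
    push_cast
    have : (Real.pi : ℂ) ≠ 0 := by exact_mod_cast Real.pi_ne_zero
    field_simp

set_option maxHeartbeats 400000 in
/-- `S(x,z)=Σ e^{2imx} v_m(z)`; 1D almost orthogonality in `L^s`, `1 < s < 2`. -/
lemma hp_orth (k : ℝ → ℂ) (hk : Continuous k) (C : ℝ) (hC : 0 < C)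
    (hkC : ∀ y, ‖k y‖ ≤ C * (1 + y ^ 2)⁻¹) {s : ℝ} (hs1 : 1 < s) (hs2 : s < 2) :
    ∃ B : ℝ≥0∞, B ≠ ⊤ ∧ ∀ (F : Finset ℤ) (v : ℤ → ℝ → ℂ), (∀ m, Measurable (v m)) →
      (∀ m ∈ F, ∀ x, Integrable (fun z => k (x - z) * v m z)) →
      (∀ m ∈ F, ∀ x, v m x = ∫ z, k (x - z) * v m z) →
      ∫⁻ x, ‖∑ m ∈ F, Complex.exp ((2 * m * x : ℝ) * Complex.I) * v m x‖ₑ ^ s ≤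
        B * ∑ m ∈ F, ∫⁻ x, ‖v m x‖ₑ ^ s := by
  set w : ℝ → ℝ≥0∞ := fun y => ENNReal.ofReal (C * (1 + y ^ 2)⁻¹) with hw
  have hwm : Measurable w := by fun_prop
  set W := ∫⁻ y, w y with hWdef
  have hW : W ≠ ⊤ := by
    have : Integrable (fun y : ℝ => C * (1 + y ^ 2)⁻¹) := integrable_inv_one_add_sq.const_mul C
    exact this.lintegral_lt_top.ne
  set B0 := ENNReal.ofReal (2 + 8 * Real.pi ^ 2) with hB0
  refine ⟨W ^ (s - 1) * (B0 * W), by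
    refine ENNReal.mul_ne_top (ENNReal.rpow_ne_top_of_nonneg (by linarith) hW)
      (ENNReal.mul_ne_top ENNReal.ofReal_ne_top hW), ?_⟩
  intro F v hv hintg hrep
  set S : ℝ → ℝ → ℂ := fun x z => ∑ m ∈ F, Complex.exp ((2 * m * x : ℝ) * Complex.I) * v m z with hS
  have hSm : Measurable (Function.uncurry S) := by
    simp only [hS, Function.uncurry_def]
    refine Finset.measurable_sum _ fun m _ => ?_
    refine Measurable.mul (by fun_prop) ((hv m).comp measurable_snd)
  have hSx : ∀ x, Measurable (S x) := fun x => hSm.of_uncurry_left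
  -- pointwise
  have h1 : ∀ x, ‖S x x‖ₑ ^ s ≤ W ^ (s - 1) * ∫⁻ z, w (x - z) * ‖S x z‖ₑ ^ s := by
    intro x
    have e : S x x = ∫ z, k (x - z) * S x z := by
      simp only [hS]
      simp_rw [Finset.mul_sum]
      rw [integral_finsetSum]
      · refine Finset.sum_congr rfl fun m hm => ?_
        rw [hrep m hm x, ← integral_const_mul]
        congr 1; ext z; ring
      · intro m hm
        refine ((hintg m hm x).const_mul (Complex.exp ((2 * m * x : ℝ) * Complex.I))).congr
          (Filter.Eventually.of_forall fun z => ?_)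
        simp only; ring
    have h2 : ‖S x x‖ₑ ≤ ∫⁻ z, w (x - z) * ‖S x z‖ₑ := by
      rw [e]
      refine (enorm_integral_le_lintegral_enorm _).trans (lintegral_mono fun z => ?_)
      rw [enorm_mul]
      gcongr
      rw [← ofReal_norm]
      exact ENNReal.ofReal_le_ofReal (hkC _)
    refine (ENNReal.rpow_le_rpow h2 (by linarith)).trans ?_
    refine (hp_jensen volume (fun z => w (x - z)) (fun z => ‖S x z‖ₑ) (hwm.comp (by fun_prop))
      (hSx x).enorm hs1).trans (le_of_eq ?_)
    congr 2
    exact lintegral_sub_left_eq_self w x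
  have hpi0 : ENNReal.ofReal (2 * Real.pi) ≠ 0 := by simp [Real.pi_pos]
  -- fixed z
  have h3 : ∀ z, ∫⁻ x, w (x - z) * ‖S x z‖ₑ ^ s ≤ B0 * W * ∑ m ∈ F, ‖v m z‖ₑ ^ s := by
    intro z
    have hg : Measurable fun x => ‖S x z‖ₑ ^ s :=
      (hSm.comp (measurable_id.prodMk measurable_const)).enorm.pow_const s
    have hwle : ∀ y, ENNReal.ofReal (2 * Real.pi) * w y ≤
        B0 * ∫⁻ h in Ioc 0 (2 * Real.pi), w (y + h) := by
      intro y
      have : ∫⁻ h in Ioc 0 (2 * Real.pi), w y ≤ ∫⁻ h in Ioc 0 (2 * Real.pi), B0 * w (y + h) := by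
        refine setLIntegral_mono (by fun_prop) fun h hh => ?_
        simp only [hw, hB0]
        rw [← ENNReal.ofReal_mul (by positivity)]
        apply ENNReal.ofReal_le_ofReal
        rw [mul_left_comm]
        refine mul_le_mul_of_nonneg_left ?_ hC.le
        rw [inv_eq_one_div, inv_eq_one_div, mul_one_div, div_le_div_iff₀ (by positivity) (by positivity)]
        have : h ^ 2 ≤ (2 * Real.pi) ^ 2 := pow_le_pow_left₀ hh.1.le hh.2 2
        nlinarith [sq_nonneg (y - h), mul_nonneg (sq_nonneg y) (sq_nonneg Real.pi)]
      rw [lintegral_const_mul _ (by fun_prop)] at this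
      simpa [mul_comm] using this
    have h4 : ENNReal.ofReal (2 * Real.pi) * ∫⁻ x, w (x - z) * ‖S x z‖ₑ ^ s ≤
        ENNReal.ofReal (2 * Real.pi) * (B0 * W * ∑ m ∈ F, ‖v m z‖ₑ ^ s) := by
      calc _ = ∫⁻ x, ENNReal.ofReal (2 * Real.pi) * w (x - z) * ‖S x z‖ₑ ^ s := by
            rw [← lintegral_const_mul _ (by fun_prop)]; simp_rw [mul_assoc]
        _ ≤ ∫⁻ x, B0 * ∫⁻ h in Ioc 0 (2 * Real.pi), w (x - z + h) * ‖S x z‖ₑ ^ s := by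
            refine lintegral_mono fun x => ?_
            simp only
            rw [lintegral_mul_const _ (by fun_prop), ← mul_assoc]
            exact mul_le_mul_left (hwle (x - z)) _
        _ = B0 * ∫⁻ x, ∫⁻ h in Ioc 0 (2 * Real.pi), w (x - z + h) * ‖S x z‖ₑ ^ s := by
            rw [lintegral_const_mul']
            exact ENNReal.ofReal_ne_top
        _ = B0 * ∫⁻ h in Ioc 0 (2 * Real.pi), ∫⁻ x, w (x - z + h) * ‖S x z‖ₑ ^ s := by
            rw [lintegral_lintegral_swap]
            refine Measurable.aemeasurable ?_
            simp only [Function.uncurry_def]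
            refine Measurable.mul (by fun_prop) (hg.comp measurable_fst)
        _ = B0 * ∫⁻ h in Ioc 0 (2 * Real.pi), ∫⁻ y, w y * ‖S (y + z - h) z‖ₑ ^ s := by
            congr 1
            refine lintegral_congr fun h => ?_
            rw [← lintegral_add_right_eq_self _ (z - h)]
            refine lintegral_congr fun y => ?_
            ring_nf
        _ = B0 * ∫⁻ y, w y * ∫⁻ h in Ioc 0 (2 * Real.pi), ‖S (y + z - h) z‖ₑ ^ s := by
            rw [lintegral_lintegral_swap]
            · congr 1
              refine lintegral_congr fun y => ?_
              rw [lintegral_const_mul]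
              exact hg.comp (by fun_prop)
            · refine Measurable.aemeasurable ?_
              simp only [Function.uncurry_def]
              refine Measurable.mul (by fun_prop)
                (hg.comp (g := fun x => ‖S x z‖ₑ ^ s) (f := fun q : ℝ × ℝ => q.2 + z - q.1) (by fun_prop))
        _ ≤ B0 * ∫⁻ y, w y * (ENNReal.ofReal (2 * Real.pi) * ∑ m ∈ F, ‖v m z‖ₑ ^ s) := by
            gcongr with y
            have := hp_exp_orth_s F (fun m => Complex.exp ((2 * m * (y + z) : ℝ) * Complex.I) * v m z)
              hs1 hs2
            simp only [enorm_mul] at this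
            have e5 : ∀ r : ℝ, ‖Complex.exp (r * Complex.I)‖ₑ = 1 := by
              intro r; rw [← ofReal_norm, Complex.norm_exp_ofReal_mul_I]; simp
            simp only [e5, one_mul] at this
            refine le_trans (le_of_eq ?_) this
            refine lintegral_congr fun h => ?_
            simp only [hS]
            congr 2
            refine Finset.sum_congr rfl fun m _ => ?_
            rw [← mul_assoc, ← Complex.exp_add]
            congr 2
            push_cast; ring
        _ = _ := by
            rw [lintegral_mul_const _ hwm]; ring
    exact (ENNReal.mul_le_mul_iff_right hpi0 ENNReal.ofReal_ne_top).1 h4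
  calc _ ≤ ∫⁻ x, W ^ (s - 1) * ∫⁻ z, w (x - z) * ‖S x z‖ₑ ^ s := lintegral_mono h1
    _ = W ^ (s - 1) * ∫⁻ z, ∫⁻ x, w (x - z) * ‖S x z‖ₑ ^ s := by
        rw [lintegral_const_mul', lintegral_lintegral_swap]
        · refine Measurable.aemeasurable ?_
          simp only [Function.uncurry_def]
          refine Measurable.mul (by fun_prop) (hSm.enorm.pow_const s)
        · exact ENNReal.rpow_ne_top_of_nonneg (by linarith) hW
    _ ≤ W ^ (s - 1) * ∫⁻ z, B0 * W * ∑ m ∈ F, ‖v m z‖ₑ ^ s := by gcongr with z; exact h3 z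
    _ = _ := by
        rw [lintegral_const_mul', lintegral_finsetSum, ← mul_assoc]
        · intro m _; exact (hv m).enorm.pow_const s
        · exact ENNReal.mul_ne_top ENNReal.ofReal_ne_top hW


/-- Oscillatory integral in one variable. -/
noncomputable def hpU {α : Type*} [MeasurableSpace α] (ν : Measure α) (l : α → ℝ) (c : α → ℂ)
    (x : ℝ) : ℂ := ∫ z, Complex.exp ((l z * x : ℝ) * Complex.I) * c z ∂ν

lemma hpU_int {α : Type*} [MeasurableSpace α] (ν : Measure α) [IsFiniteMeasure ν] (l : α → ℝ)
    (c : α → ℂ) (hl : Measurable l) (hc : Measurable c) (hc1 : ∀ z, ‖c z‖ ≤ 1) (x : ℝ) :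
    Integrable (fun z => Complex.exp ((l z * x : ℝ) * Complex.I) * c z) ν := by
  refine Integrable.of_bound (C := 1) (by fun_prop) (Filter.Eventually.of_forall fun z => ?_)
  rw [norm_mul, Complex.norm_exp_ofReal_mul_I, one_mul]; exact hc1 z

lemma hpU_meas {α : Type*} [MeasurableSpace α] (ν : Measure α) [IsFiniteMeasure ν] (l : α → ℝ)
    (c : α → ℂ) (hl : Measurable l) (hc : Measurable c) : Measurable (hpU ν l c) := by
  have : Measurable (fun q : ℝ × α => Complex.exp ((l q.2 * q.1 : ℝ) * Complex.I) * c q.2) := by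
    fun_prop
  exact this.stronglyMeasurable.integral_prod_right'.measurable

lemma hpU_rep (k : ℝ → ℂ) (hk : Continuous k) (hki : Integrable k)
    (hk1 : ∀ l : ℝ, |l| ≤ 5 → ∫ y, k y * Complex.exp (-(l * y : ℝ) * Complex.I) = 1)
    {α : Type*} [MeasurableSpace α] (ν : Measure α) [IsFiniteMeasure ν] (l : α → ℝ)
    (c : α → ℂ) (hl : Measurable l) (hc : Measurable c) (hc1 : ∀ z, ‖c z‖ ≤ 1)
    (hl5 : ∀ᵐ z ∂ν, |l z| ≤ 5) (x : ℝ) :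
    Integrable (fun y => k (x - y) * hpU ν l c y) ∧
    hpU ν l c x = ∫ y, k (x - y) * hpU ν l c y := by
  have hkm := hk.measurable
  have hintg : Integrable (fun q : ℝ × α =>
      k (x - q.1) * (Complex.exp ((l q.2 * q.1 : ℝ) * Complex.I) * c q.2)) (volume.prod ν) := by
    have h1 : Integrable (fun q : ℝ × α => k (x - q.1) * (1 : ℂ)) (volume.prod ν) :=
      (hki.comp_sub_left x).mul_prod (integrable_const 1)
    refine h1.mono (by fun_prop) (Filter.Eventually.of_forall fun q => ?_)
    rw [norm_mul, norm_mul, norm_mul, Complex.norm_exp_ofReal_mul_I, one_mul]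
    refine mul_le_mul_of_nonneg_left ?_ (norm_nonneg _)
    simpa using hc1 q.2
  have e1 : ∀ y, k (x - y) * hpU ν l c y =
      ∫ z, k (x - y) * (Complex.exp ((l z * y : ℝ) * Complex.I) * c z) ∂ν := by
    intro y; rw [integral_const_mul]; rfl
  constructor
  · simp_rw [e1]
    exact hintg.integral_prod_left
  · simp_rw [e1]
    rw [integral_integral_swap hintg]
    refine integral_congr_ae ?_
    filter_upwards [hl5] with z hz
    have h2 := hk1 (l z) hz
    rw [← integral_sub_left_eq_self _ volume x] at h2
    have : ∀ y : ℝ, k (x - y) * (Complex.exp ((l z * y : ℝ) * Complex.I) * c z) =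
        (Complex.exp ((l z * x : ℝ) * Complex.I) * c z) *
          (k (x - y) * Complex.exp (-(l z * (x - y) : ℝ) * Complex.I)) := by
      intro y
      have : Complex.exp ((l z * y : ℝ) * Complex.I) = Complex.exp ((l z * x : ℝ) * Complex.I) *
          Complex.exp (-(l z * (x - y) : ℝ) * Complex.I) := by
        rw [← Complex.exp_add]; congr 1; push_cast; ring
      rw [this]; ring
    simp_rw [this]
    rw [integral_const_mul, h2, mul_one]

lemma hp_L1D {s : ℝ} (hs1 : 1 < s) (hs2 : s < 2) :
    ∃ B : ℝ≥0∞, B ≠ ⊤ ∧ ∀ {α : Type} [MeasurableSpace α] (ν : Measure α) [IsFiniteMeasure ν]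
      (a b : α → ℝ) (c : α → ℂ), Measurable a → Measurable b → Measurable c → (∀ z, ‖c z‖ ≤ 1) →
      ∀ F : Finset ℤ, (∀ᵐ z ∂ν, ⌊a z⌋ ∈ F) →
      (∀ᵐ z ∂ν, ⌊b z⌋ - ⌊a z⌋ ∈ ({-3, -2, 2, 3} : Finset ℤ)) →
      ∫⁻ x, ‖hpU ν (a + b) c x‖ₑ ^ s ≤
        B * ∑ o ∈ ({-3, -2, 2, 3} : Finset ℤ), ∑ m ∈ F, ∫⁻ x,
          ‖hpU (ν.restrict {z | ⌊a z⌋ = m ∧ ⌊b z⌋ = m + o}) (a + b) c x‖ₑ ^ s := by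
  obtain ⟨k, hk, hki, ⟨C, hC, hkC⟩, hk1⟩ := hp_kernel
  obtain ⟨B, hB, horth⟩ := hp_orth k hk C hC hkC hs1 hs2
  set O : Finset ℤ := {-3, -2, 2, 3} with hO
  refine ⟨(4 : ℝ≥0∞) ^ (s - 1) * B, ENNReal.mul_ne_top
    (ENNReal.rpow_ne_top_of_nonneg (by linarith) (by norm_num)) hB, ?_⟩
  intro α _ ν _ a b c ha hb hc hc1 F haF hbO
  set Z : ℤ → ℤ → Set α := fun o m => {z | ⌊a z⌋ = m ∧ ⌊b z⌋ = m + o} with hZ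
  have hZm : ∀ o m, MeasurableSet (Z o m) := by
    intro o m
    have h1 : Measurable fun z => ⌊a z⌋ := ha.floor
    have h2 : Measurable fun z => ⌊b z⌋ := hb.floor
    exact (h1 (measurableSet_singleton m)).inter (h2 (measurableSet_singleton (m + o)))
  set u : ℤ → ℤ → ℝ → ℂ := fun o m => hpU (ν.restrict (Z o m)) (a + b) c with hu
  have hum : ∀ o m, Measurable (u o m) := fun o m => hpU_meas _ _ _ (ha.add hb) hc
  have hsum : ∀ x, hpU ν (a + b) c x = ∑ o ∈ O, ∑ m ∈ F, u o m x := by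
    intro x
    simp only [hu, hpU]
    rw [← Finset.sum_product' O F (f := fun o m => ∫ z in Z o m, _ ∂ν)]
    rw [← integral_biUnion_finset (s := fun q : ℤ × ℤ => Z q.1 q.2)]
    · rw [Measure.restrict_eq_self_of_ae_mem]
      filter_upwards [haF, hbO] with z h1 h2
      simp only [mem_iUnion]
      refine ⟨(⌊b z⌋ - ⌊a z⌋, ⌊a z⌋), Finset.mem_product.2 ⟨h2, h1⟩, rfl, by simp⟩
    · intro q _; exact hZm _ _
    · intro q _ q' _ hne
      refine Set.disjoint_left.2 fun z hz hz' => hne ?_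
      obtain ⟨h1, h2⟩ := hz
      obtain ⟨h3, h4⟩ := hz'
      ext <;> omega
    · intro q _
      exact (hpU_int ν (a + b) c (ha.add hb) hc hc1 x).integrableOn
  have h1 : ∀ x, ‖hpU ν (a + b) c x‖ₑ ^ s ≤
      (4 : ℝ≥0∞) ^ (s - 1) * ∑ o ∈ O, ‖∑ m ∈ F, u o m x‖ₑ ^ s := by
    intro x
    rw [hsum x]
    refine (ENNReal.rpow_le_rpow (enorm_sum_le _ _) (by linarith)).trans ?_
    refine (ENNReal.rpow_sum_le_const_mul_sum_rpow O _ hs1.le).trans (le_of_eq ?_)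
    have : O.card = 4 := by rw [hO]; decide
    rw [this]; norm_num
  have h2 : ∀ o ∈ O, ∫⁻ x, ‖∑ m ∈ F, u o m x‖ₑ ^ s ≤ B * ∑ m ∈ F, ∫⁻ x, ‖u o m x‖ₑ ^ s := by
    intro o ho
    set v : ℤ → ℝ → ℂ := fun m => hpU (ν.restrict (Z o m)) (fun z => a z + b z - 2 * m) c with hv
    have huv : ∀ m x, u o m x = Complex.exp ((2 * m * x : ℝ) * Complex.I) * v m x := by
      intro m x
      simp only [hu, hv, hpU]
      rw [← integral_const_mul]
      refine integral_congr_ae (Filter.Eventually.of_forall fun z => ?_)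
      simp only [Pi.add_apply]
      rw [← mul_assoc, ← Complex.exp_add]
      congr 2; push_cast; ring
    have hl5 : ∀ m : ℤ, ∀ᵐ z ∂(ν.restrict (Z o m)), |a z + b z - 2 * m| ≤ 5 := by
      intro m
      refine (ae_restrict_iff' (hZm o m)).2 (Filter.Eventually.of_forall fun z hz => ?_)
      obtain ⟨h1, h2⟩ := hz
      rw [Int.floor_eq_iff] at h1 h2
      have ho' : (-3 : ℝ) ≤ o ∧ (o : ℝ) ≤ 3 := by
        have : -3 ≤ o ∧ o ≤ 3 := by
          simp only [hO, Finset.mem_insert, Finset.mem_singleton] at ho; omega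
        exact_mod_cast this
      push_cast at h2
      rw [abs_le]; constructor <;> linarith
    have hrep := fun m : ℤ => hpU_rep k hk hki hk1 (ν.restrict (Z o m)) (fun z => a z + b z - 2 * m) c
      (by fun_prop) hc hc1 (hl5 m)
    have := horth F v (fun m => hpU_meas _ _ _ (by fun_prop) hc) (fun m _ x => (hrep m x).1)
      (fun m _ x => (hrep m x).2)
    simp_rw [huv]
    refine this.trans (le_of_eq ?_)
    congr 1
    refine Finset.sum_congr rfl fun m _ => lintegral_congr fun x => ?_
    rw [enorm_mul]
    have e5 : ∀ r : ℝ, ‖Complex.exp (r * Complex.I)‖ₑ = 1 := by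
      intro r; rw [← ofReal_norm, Complex.norm_exp_ofReal_mul_I]; simp
    rw [e5, one_mul]
  calc _ ≤ ∫⁻ x, (4 : ℝ≥0∞) ^ (s - 1) * ∑ o ∈ O, ‖∑ m ∈ F, u o m x‖ₑ ^ s := lintegral_mono h1
    _ = (4 : ℝ≥0∞) ^ (s - 1) * ∑ o ∈ O, ∫⁻ x, ‖∑ m ∈ F, u o m x‖ₑ ^ s := by
        have hm : ∀ o, Measurable fun x => ‖∑ m ∈ F, u o m x‖ₑ ^ s := fun o =>
          (Finset.measurable_sum _ fun m _ => hum o m).enorm.pow_const s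
        rw [lintegral_const_mul _ (Finset.measurable_sum _ fun o _ => hm o),
          lintegral_finsetSum _ fun o _ => hm o]
    _ ≤ (4 : ℝ≥0∞) ^ (s - 1) * ∑ o ∈ O, B * ∑ m ∈ F, ∫⁻ x, ‖u o m x‖ₑ ^ s := by
        gcongr with o ho; exact h2 o ho
    _ = _ := by rw [← Finset.mul_sum, mul_assoc]


noncomputable def hpPh (p : ℝ × ℝ × ℝ) (ξ : ℝ × ℝ) : ℂ :=
  Complex.exp (Complex.I * (p.1 * ξ.1 * ξ.2 + p.2.1 * ξ.1 + p.2.2 * ξ.2 : ℝ))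

noncomputable def hpT (V : Set ((ℝ × ℝ) × (ℝ × ℝ))) (p : ℝ × ℝ × ℝ) : ℂ :=
  ∫ z in V, hpPh p z.1 * hpPh p z.2

lemma hpPh_norm (p : ℝ × ℝ × ℝ) (ξ : ℝ × ℝ) : ‖hpPh p ξ‖ = 1 := by
  rw [hpPh, mul_comm, Complex.norm_exp_ofReal_mul_I]

lemma hpPh_meas : Measurable (Function.uncurry hpPh) := by
  unfold hpPh Function.uncurry; fun_prop

lemma hpPh_meas1 (p : ℝ × ℝ × ℝ) : Measurable (hpPh p) := by
  unfold hpPh; fun_prop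

lemma hp_ext (Ω : Set (ℝ × ℝ)) (hΩ : MeasurableSet Ω) (p : ℝ × ℝ × ℝ) :
    extOp (chi Ω) p = ∫ ξ in Ω, hpPh p ξ := by
  rw [← integral_indicator hΩ]
  unfold extOp chi
  congr 1; ext ξ
  by_cases h : ξ ∈ Ω <;> simp [h, hpPh]

lemma hp_ext_mul (Ω Ω' : Set (ℝ × ℝ)) (hΩ : MeasurableSet Ω) (hΩ' : MeasurableSet Ω')
    (p : ℝ × ℝ × ℝ) : extOp (chi Ω) p * extOp (chi Ω') p = hpT (Ω ×ˢ Ω') p := by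
  rw [hp_ext Ω hΩ, hp_ext Ω' hΩ', hpT]
  exact (setIntegral_prod_mul _ _ Ω Ω').symm

lemma hpT_meas (V : Set ((ℝ × ℝ) × (ℝ × ℝ))) : Measurable (hpT V) := by
  have : Measurable (fun q : (ℝ × ℝ × ℝ) × ((ℝ × ℝ) × (ℝ × ℝ)) =>
      hpPh q.1 q.2.1 * hpPh q.1 q.2.2) := by
    unfold hpPh; fun_prop
  exact (this.stronglyMeasurable.integral_prod_right' (ν := volume.restrict V)).measurable

lemma hp_ext_meas (Ω : Set (ℝ × ℝ)) (hΩ : MeasurableSet Ω) : Measurable (extOp (chi Ω)) := by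
  have : Measurable (fun q : (ℝ × ℝ × ℝ) × (ℝ × ℝ) => hpPh q.1 q.2) := hpPh_meas
  have h2 := (this.stronglyMeasurable.integral_prod_right' (ν := volume.restrict Ω)).measurable
  have h3 : extOp (chi Ω) = fun p => ∫ ξ in Ω, hpPh p ξ := by ext p; exact hp_ext Ω hΩ p
  rw [h3]; exact h2

lemma hpT_int (V : Set ((ℝ × ℝ) × (ℝ × ℝ))) (hV : volume V ≠ ⊤) (p : ℝ × ℝ × ℝ) :
    IntegrableOn (fun z : (ℝ × ℝ) × (ℝ × ℝ) => hpPh p z.1 * hpPh p z.2) V := by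
  have : IsFiniteMeasure (volume.restrict V) := ⟨by simpa using hV.lt_top⟩
  have hm := hpPh_meas1 p
  refine Integrable.of_bound (C := 1) (by fun_prop) (Filter.Eventually.of_forall fun z => ?_)
  rw [norm_mul, hpPh_norm, hpPh_norm, one_mul]

lemma hp_tonelli (f : ℝ × ℝ × ℝ → ℝ≥0∞) (hf : Measurable f) :
    ∫⁻ p, f p = ∫⁻ t, ∫⁻ x₁, ∫⁻ x₂, f (t, x₁, x₂) := by
  rw [Measure.volume_eq_prod, lintegral_prod _ hf.aemeasurable]
  refine lintegral_congr fun t => ?_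
  rw [Measure.volume_eq_prod, lintegral_prod]
  exact (hf.comp (by fun_prop)).aemeasurable

lemma hp_tonelli' (f : ℝ × ℝ × ℝ → ℝ≥0∞) (hf : Measurable f) :
    ∫⁻ p, f p = ∫⁻ t, ∫⁻ x₂, ∫⁻ x₁, f (t, x₁, x₂) := by
  rw [hp_tonelli f hf]
  refine lintegral_congr fun t => ?_
  rw [lintegral_lintegral_swap]
  exact (hf.comp (f := fun q : ℝ × ℝ => (t, q.1, q.2)) (by fun_prop)).aemeasurable

def hpO : Finset ℤ := {-3, -2, 2, 3}

def hpZ1 (o m : ℤ) : Set ((ℝ × ℝ) × (ℝ × ℝ)) := {z | ⌊z.1.1⌋ = m ∧ ⌊z.2.1⌋ = m + o}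
def hpZ2 (o m : ℤ) : Set ((ℝ × ℝ) × (ℝ × ℝ)) := {z | ⌊z.1.2⌋ = m ∧ ⌊z.2.2⌋ = m + o}

lemma hpZ1_meas (o m : ℤ) : MeasurableSet (hpZ1 o m) := by
  have h1 : Measurable fun z : (ℝ × ℝ) × (ℝ × ℝ) => ⌊z.1.1⌋ := by fun_prop
  have h2 : Measurable fun z : (ℝ × ℝ) × (ℝ × ℝ) => ⌊z.2.1⌋ := by fun_prop
  exact (h1 (measurableSet_singleton m)).inter (h2 (measurableSet_singleton (m + o)))

lemma hpZ2_meas (o m : ℤ) : MeasurableSet (hpZ2 o m) := by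
  have h1 : Measurable fun z : (ℝ × ℝ) × (ℝ × ℝ) => ⌊z.1.2⌋ := by fun_prop
  have h2 : Measurable fun z : (ℝ × ℝ) × (ℝ × ℝ) => ⌊z.2.2⌋ := by fun_prop
  exact (h1 (measurableSet_singleton m)).inter (h2 (measurableSet_singleton (m + o)))

lemma hp_sum_pull {ι κ : Type*} (O : Finset ι) (F : Finset κ) {β : Type*} [MeasurableSpace β]
    (μ : Measure β) (B : ℝ≥0∞) (g : ι → κ → β → ℝ≥0∞) (hg : ∀ o m, Measurable (g o m)) :
    ∫⁻ t, B * ∑ o ∈ O, ∑ m ∈ F, g o m t ∂μ = B * ∑ o ∈ O, ∑ m ∈ F, ∫⁻ t, g o m t ∂μ := by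
  rw [lintegral_const_mul _ (by fun_prop), lintegral_finsetSum _ (by fun_prop)]
  congr 1
  refine Finset.sum_congr rfl fun o _ => ?_
  rw [lintegral_finsetSum _ (by fun_prop)]

lemma hp_dir {s : ℝ} (hs1 : 1 < s) (hs2 : s < 2) :
    ∃ B : ℝ≥0∞, B ≠ ⊤ ∧ ∀ (V : Set ((ℝ × ℝ) × (ℝ × ℝ))), MeasurableSet V → volume V ≠ ⊤ →
      ∀ F : Finset ℤ, 
      (((∀ z ∈ V, ⌊z.1.1⌋ ∈ F) → (∀ z ∈ V, ⌊z.2.1⌋ - ⌊z.1.1⌋ ∈ hpO) →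
        ∫⁻ p, ‖hpT V p‖ₑ ^ s ≤ B * ∑ o ∈ hpO, ∑ m ∈ F, ∫⁻ p, ‖hpT (V ∩ hpZ1 o m) p‖ₑ ^ s) ∧
       ((∀ z ∈ V, ⌊z.1.2⌋ ∈ F) → (∀ z ∈ V, ⌊z.2.2⌋ - ⌊z.1.2⌋ ∈ hpO) →
        ∫⁻ p, ‖hpT V p‖ₑ ^ s ≤ B * ∑ o ∈ hpO, ∑ m ∈ F, ∫⁻ p, ‖hpT (V ∩ hpZ2 o m) p‖ₑ ^ s)) := by
  obtain ⟨B, hB, hL⟩ := hp_L1D hs1 hs2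
  refine ⟨B, hB, fun V hV hVf F => ⟨fun h1 h2 => ?_, fun h1 h2 => ?_⟩⟩
  · have : IsFiniteMeasure (volume.restrict V) := ⟨by simpa using hVf.lt_top⟩
    have hfm : ∀ V', Measurable fun p => ‖hpT V' p‖ₑ ^ s := fun V' => (hpT_meas V').enorm.pow_const s
    simp_rw [fun V' => hp_tonelli' _ (hfm V')]
    rw [← hp_sum_pull]
    swap
    · intro o m
      refine Measurable.lintegral_prod_right' (f := fun q : ℝ × ℝ => ∫⁻ x₁, ‖hpT (V ∩ hpZ1 o m) (q.1, x₁, q.2)‖ₑ ^ s) ?_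
      exact Measurable.lintegral_prod_right' (f := fun q : (ℝ × ℝ) × ℝ => ‖hpT (V ∩ hpZ1 o m) (q.1.1, q.2, q.1.2)‖ₑ ^ s)
        ((hfm _).comp (by fun_prop))
    refine lintegral_mono fun t => ?_
    rw [← hp_sum_pull]
    swap
    · intro o m
      exact Measurable.lintegral_prod_right' (f := fun q : ℝ × ℝ => ‖hpT (V ∩ hpZ1 o m) (t, q.2, q.1)‖ₑ ^ s)
        ((hfm _).comp (by fun_prop))
    refine lintegral_mono fun x₂ => ?_
    set a : (ℝ × ℝ) × (ℝ × ℝ) → ℝ := fun z => z.1.1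
    set b : (ℝ × ℝ) × (ℝ × ℝ) → ℝ := fun z => z.2.1
    set c : (ℝ × ℝ) × (ℝ × ℝ) → ℂ := fun z => hpPh (t, 0, x₂) z.1 * hpPh (t, 0, x₂) z.2 with hc
    have hcm : Measurable c := by
      have := hpPh_meas1 (t, 0, x₂); fun_prop
    have e : ∀ V' x, hpT V' (t, x, x₂) = hpU (volume.restrict V') (a + b) c x := by
      intro V' x
      unfold hpT hpU
      congr 1; ext z
      simp only [hc, hpPh, a, b, Pi.add_apply]
      simp only [← Complex.exp_add]
      congr 1; push_cast; ring
    simp_rw [e]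
    have := hL (volume.restrict V) a b c (by fun_prop) (by fun_prop) hcm
      (fun z => by simp [hc, hpPh_norm]) F
      ((ae_restrict_iff' hV).2 (Filter.Eventually.of_forall h1))
      ((ae_restrict_iff' hV).2 (Filter.Eventually.of_forall h2))
    refine this.trans (le_of_eq ?_)
    congr 1
    refine Finset.sum_congr rfl fun o _ => Finset.sum_congr rfl fun m _ => ?_
    rw [inter_comm, ← Measure.restrict_restrict (hpZ1_meas o m)]
    rfl
  · have : IsFiniteMeasure (volume.restrict V) := ⟨by simpa using hVf.lt_top⟩
    have hfm : ∀ V', Measurable fun p => ‖hpT V' p‖ₑ ^ s := fun V' => (hpT_meas V').enorm.pow_const s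
    simp_rw [fun V' => hp_tonelli _ (hfm V')]
    rw [← hp_sum_pull]
    swap
    · intro o m
      refine Measurable.lintegral_prod_right' (f := fun q : ℝ × ℝ => ∫⁻ x₁, ‖hpT (V ∩ hpZ2 o m) (q.1, q.2, x₁)‖ₑ ^ s) ?_
      exact Measurable.lintegral_prod_right' (f := fun q : (ℝ × ℝ) × ℝ => ‖hpT (V ∩ hpZ2 o m) (q.1.1, q.1.2, q.2)‖ₑ ^ s)
        ((hfm _).comp (by fun_prop))
    refine lintegral_mono fun t => ?_
    rw [← hp_sum_pull]
    swap
    · intro o m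
      exact Measurable.lintegral_prod_right' (f := fun q : ℝ × ℝ => ‖hpT (V ∩ hpZ2 o m) (t, q.1, q.2)‖ₑ ^ s)
        ((hfm _).comp (by fun_prop))
    refine lintegral_mono fun x₁ => ?_
    set a : (ℝ × ℝ) × (ℝ × ℝ) → ℝ := fun z => z.1.2
    set b : (ℝ × ℝ) × (ℝ × ℝ) → ℝ := fun z => z.2.2
    set c : (ℝ × ℝ) × (ℝ × ℝ) → ℂ := fun z => hpPh (t, x₁, 0) z.1 * hpPh (t, x₁, 0) z.2 with hc
    have hcm : Measurable c := by
      have := hpPh_meas1 (t, x₁, 0); fun_prop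
    have e : ∀ V' x, hpT V' (t, x₁, x) = hpU (volume.restrict V') (a + b) c x := by
      intro V' x
      unfold hpT hpU
      congr 1; ext z
      simp only [hc, hpPh, a, b, Pi.add_apply]
      simp only [← Complex.exp_add]
      congr 1; push_cast; ring
    simp_rw [e]
    have := hL (volume.restrict V) a b c (by fun_prop) (by fun_prop) hcm
      (fun z => by simp [hc, hpPh_norm]) F
      ((ae_restrict_iff' hV).2 (Filter.Eventually.of_forall h1))
      ((ae_restrict_iff' hV).2 (Filter.Eventually.of_forall h2))
    refine this.trans (le_of_eq ?_)
    congr 1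
    refine Finset.sum_congr rfl fun o _ => Finset.sum_congr rfl fun m _ => ?_
    rw [inter_comm, ← Measure.restrict_restrict (hpZ2_meas o m)]
    rfl

lemma hp_dir2 {s : ℝ} (hs1 : 1 < s) (hs2 : s < 2) :
    ∃ B : ℝ≥0∞, B ≠ ⊤ ∧ ∀ (V : Set ((ℝ × ℝ) × (ℝ × ℝ))), MeasurableSet V → volume V ≠ ⊤ →
      ∀ F : Finset ℤ,
      (∀ z ∈ V, ⌊z.1.1⌋ ∈ F) → (∀ z ∈ V, ⌊z.2.1⌋ - ⌊z.1.1⌋ ∈ hpO) →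
      (∀ z ∈ V, ⌊z.1.2⌋ ∈ F) → (∀ z ∈ V, ⌊z.2.2⌋ - ⌊z.1.2⌋ ∈ hpO) →
        ∫⁻ p, ‖hpT V p‖ₑ ^ s ≤ B * ∑ o₁ ∈ hpO, ∑ m₁ ∈ F, ∑ o₂ ∈ hpO, ∑ m₂ ∈ F,
          ∫⁻ p, ‖hpT (V ∩ hpZ1 o₁ m₁ ∩ hpZ2 o₂ m₂) p‖ₑ ^ s := by
  obtain ⟨B, hB, hL⟩ := hp_dir hs1 hs2
  refine ⟨B * B, ENNReal.mul_ne_top hB hB, fun V hV hVf F h1 h2 h3 h4 => ?_⟩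
  refine ((hL V hV hVf F).1 h1 h2).trans ?_
  rw [mul_assoc]
  refine mul_le_mul_right ?_ _
  rw [Finset.mul_sum]
  refine Finset.sum_le_sum fun o₁ _ => ?_
  rw [Finset.mul_sum]
  refine Finset.sum_le_sum fun m₁ _ => ?_
  exact (hL (V ∩ hpZ1 o₁ m₁) (hV.inter (hpZ1_meas _ _))
    (measure_ne_top_of_subset inter_subset_left hVf) F).2 (fun z hz => h3 z hz.1)
    (fun z hz => h4 z hz.1)


def hpSq (m₁ m₂ : ℤ) : Set (ℝ × ℝ) := {ξ | ⌊ξ.1⌋ = m₁ ∧ ⌊ξ.2⌋ = m₂}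

lemma hpSq_meas (m₁ m₂ : ℤ) : MeasurableSet (hpSq m₁ m₂) := by
  have h1 : Measurable fun z : ℝ × ℝ => ⌊z.1⌋ := by fun_prop
  have h2 : Measurable fun z : ℝ × ℝ => ⌊z.2⌋ := by fun_prop
  exact (h1 (measurableSet_singleton m₁)).inter (h2 (measurableSet_singleton m₂))

lemma hpSq_sub (m₁ m₂ : ℤ) : hpSq m₁ m₂ ⊆ unitSq m₁ m₂ := by
  rintro ⟨x, y⟩ ⟨h1, h2⟩
  simp only [Int.floor_eq_iff] at h1 h2
  exact ⟨⟨h1.1, h1.2.le⟩, ⟨h2.1, h2.2.le⟩⟩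

lemma hpSq_vol (m₁ m₂ : ℤ) : volume (hpSq m₁ m₂) ≤ 1 := by
  refine (measure_mono (hpSq_sub m₁ m₂)).trans ?_
  rw [unitSq, Measure.volume_eq_prod, Measure.prod_prod]
  simp

lemma hp_chi_norm (Ω : Set (ℝ × ℝ)) (hΩ : MeasurableSet Ω) (hv : volume Ω ≤ 1) {r r0 : ℝ}
    (hr0 : 0 < r0) (hr : r < r0) :
    eLpNorm (chi Ω) (ENNReal.ofReal r) volume ≤ volume Ω ^ (1 / r0) := by
  rcases le_or_gt r 0 with h | h
  · rw [ENNReal.ofReal_of_nonpos h]; simp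
  · unfold chi
    rw [eLpNorm_indicator_const hΩ (by simpa using h) ENNReal.ofReal_ne_top,
      ENNReal.toReal_ofReal h.le]
    simp only [enorm_one, one_mul]
    exact ENNReal.rpow_le_rpow_of_exponent_ge hv (one_div_le_one_div_of_le h hr.le)

lemma hp_BH {s r A r0 : ℝ} (hr0 : 0 < r0) (hr : r < r0) (hBH : BH s r A)
    (m₁ m₂ o₁ o₂ : ℤ) (ho₁ : o₁ ∈ hpO) (ho₂ : o₂ ∈ hpO) (Ω Ω' : Set (ℝ × ℝ))
    (hΩ : MeasurableSet Ω) (hΩ' : MeasurableSet Ω')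
    (hs : Ω ⊆ hpSq m₁ m₂) (hs' : Ω' ⊆ hpSq (m₁ + o₁) (m₂ + o₂)) :
    eLpNorm (hpT (Ω ×ˢ Ω')) (ENNReal.ofReal s) volume ≤
      ENNReal.ofReal A * (volume Ω * volume Ω') ^ (1 / r0) := by
  have key : ∀ m o : ℤ, o ∈ hpO → 2 ≤ |(m : ℝ) - ((m + o : ℤ) : ℝ)| ∧
      |(m : ℝ) - ((m + o : ℤ) : ℝ)| ≤ 5 := by
    intro m o ho
    have e : (m : ℝ) - ((m + o : ℤ) : ℝ) = ((-o : ℤ) : ℝ) := by push_cast; ring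
    rw [e, ← Int.cast_abs]
    have : 2 ≤ |-o| ∧ |-o| ≤ 5 := by
      simp only [hpO, Finset.mem_insert, Finset.mem_singleton] at ho
      rcases ho with rfl | rfl | rfl | rfl <;> decide
    exact_mod_cast this
  have hsup : ∀ X : Set (ℝ × ℝ), Function.support (chi X) ⊆ X := fun X => by
    unfold chi; exact support_indicator_subset
  have h := hBH m₁ m₂ ((m₁ + o₁ : ℤ) : ℝ) ((m₂ + o₂ : ℤ) : ℝ) (key m₁ o₁ ho₁).1 (key m₁ o₁ ho₁).2
    (key m₂ o₂ ho₂).1 (key m₂ o₂ ho₂).2 (chi Ω) (chi Ω')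
    ((hsup Ω).trans (hs.trans (hpSq_sub _ _))) ((hsup Ω').trans (hs'.trans (hpSq_sub _ _)))
  have e : hpT (Ω ×ˢ Ω') = fun p => extOp (chi Ω) p * extOp (chi Ω') p := by
    ext p; rw [hp_ext_mul Ω Ω' hΩ hΩ']
  rw [e, ENNReal.mul_rpow_of_nonneg _ _ (by positivity), ← mul_assoc]
  refine h.trans ?_
  gcongr
  · exact hp_chi_norm Ω hΩ ((measure_mono hs).trans (hpSq_vol _ _)) hr0 hr
  · exact hp_chi_norm Ω' hΩ' ((measure_mono hs').trans (hpSq_vol _ _)) hr0 hr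

def hpW0 : Set (ℝ × ℝ) := {q | 2 ≤ |⌊q.1⌋ - ⌊q.2⌋| ∧ |⌊q.1⌋ / 2 - ⌊q.2⌋ / 2| ≤ 1}

lemma hpW0_meas : MeasurableSet hpW0 := by
  have h : Measurable fun q : ℝ × ℝ => (⌊q.1⌋, ⌊q.2⌋) := by fun_prop
  exact h (t := {q : ℤ × ℤ | 2 ≤ |q.1 - q.2| ∧ |q.1 / 2 - q.2 / 2| ≤ 1}) (MeasurableSet.of_discrete)

lemma hpW0_O {x y : ℝ} (h : (x, y) ∈ hpW0) : ⌊y⌋ - ⌊x⌋ ∈ hpO := by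
  obtain ⟨h1, h2⟩ := h
  simp only at h1 h2
  simp only [hpO, Finset.mem_insert, Finset.mem_singleton]
  rw [le_abs] at h1; rw [abs_le] at h2
  omega

def hpWW : Set ((ℝ × ℝ) × (ℝ × ℝ)) := {z | (z.1.1, z.2.1) ∈ hpW0 ∧ (z.1.2, z.2.2) ∈ hpW0}

lemma hpWW_meas : MeasurableSet hpWW := by
  have h1 : Measurable fun z : (ℝ × ℝ) × (ℝ × ℝ) => (z.1.1, z.2.1) := by fun_prop
  have h2 : Measurable fun z : (ℝ × ℝ) × (ℝ × ℝ) => (z.1.2, z.2.2) := by fun_prop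
  exact (h1 hpW0_meas).inter (h2 hpW0_meas)

lemma hp_sum_vol (F : Finset (ℤ × ℤ)) (Ω : Set (ℝ × ℝ)) (hΩ : MeasurableSet Ω) (o₁ o₂ : ℤ) :
    ∑ m ∈ F, volume (Ω ∩ hpSq (m.1 + o₁) (m.2 + o₂)) ≤ volume Ω := by
  rw [← measure_biUnion_finset]
  · exact measure_mono (iUnion₂_subset fun m _ => inter_subset_left)
  · intro m _ m' _ hne
    refine Set.disjoint_left.2 fun z hz hz' => hne ?_
    obtain ⟨-, h1, h2⟩ := hz
    obtain ⟨-, h3, h4⟩ := hz'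
    ext <;> omega
  · intro m _; exact hΩ.inter (hpSq_meas _ _)

lemma hp_cs {ι : Type*} (F : Finset ι) (x y : ι → ℝ≥0∞) {X Y D D' : ℝ≥0∞} {e : ℝ} (he : 1 / 2 ≤ e)
    (hX : ∑ i ∈ F, x i ≤ X) (hY : ∑ i ∈ F, y i ≤ Y) (hD : ∀ i, x i ≤ D) (hD' : ∀ i, y i ≤ D') :
    ∑ i ∈ F, (x i * y i) ^ e ≤ (D * D') ^ (e - 1 / 2) * (X * Y) ^ (1 / 2 : ℝ) := by
  have h1 : ∀ i ∈ F, (x i * y i) ^ e ≤ (D * D') ^ (e - 1 / 2) *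
      (x i ^ (1 / 2 : ℝ) * y i ^ (1 / 2 : ℝ)) := by
    intro i _
    have : e = (e - 1 / 2) + 1 / 2 := by ring
    nth_rw 1 [this]
    rw [ENNReal.rpow_add_of_nonneg _ _ (by linarith) (by norm_num),
      ENNReal.mul_rpow_of_nonneg (x i) (y i) (by norm_num : (0:ℝ) ≤ 1 / 2)]
    gcongr
    · exact hD i
    · exact hD' i
  refine (Finset.sum_le_sum h1).trans ?_
  rw [← Finset.mul_sum]
  gcongr
  refine (ENNReal.inner_le_Lp_mul_Lq F _ _ (Real.HolderConjugate.two_two)).trans ?_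
  rw [ENNReal.mul_rpow_of_nonneg X Y (by norm_num : (0:ℝ) ≤ 1 / 2)]
  simp_rw [← ENNReal.rpow_mul]
  norm_num
  gcongr

lemma hp_unit {s r A r0 : ℝ} (hs1 : 1 < s) (hs2 : s < 2) (hr0 : 0 < r0) (hr : r < r0)
    (hsr : 1 / 2 ≤ s / r0) (hBH : BH s r A) :
    ∃ B : ℝ≥0∞, B ≠ ⊤ ∧ ∀ Ω Ω' : Set (ℝ × ℝ), MeasurableSet Ω → MeasurableSet Ω' →
      volume Ω ≠ ⊤ → volume Ω' ≠ ⊤ → ∀ N : ℝ, Ω ⊆ Icc (-N) N ×ˢ Icc (-N) N →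
      ∀ D D' : ℝ≥0∞, (∀ m₁ m₂, volume (Ω ∩ hpSq m₁ m₂) ≤ D) →
        (∀ m₁ m₂, volume (Ω' ∩ hpSq m₁ m₂) ≤ D') →
      ∫⁻ p, ‖hpT ((Ω ×ˢ Ω') ∩ hpWW) p‖ₑ ^ s ≤
        B * ((D * D') ^ (s / r0 - 1 / 2) * (volume Ω * volume Ω') ^ (1 / 2 : ℝ)) := by
  obtain ⟨B, hB, hL⟩ := hp_dir2 hs1 hs2
  refine ⟨B * (16 * ENNReal.ofReal A ^ s), ENNReal.mul_ne_top hB (ENNReal.mul_ne_top (by norm_num)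
    (ENNReal.rpow_ne_top_of_nonneg (by linarith) ENNReal.ofReal_ne_top)), ?_⟩
  intro Ω Ω' hΩ hΩ' hf hf' N hN D D' hD hD'
  set V := (Ω ×ˢ Ω') ∩ hpWW with hV
  have hVm : MeasurableSet V := (hΩ.prod hΩ').inter hpWW_meas
  have hVf : volume V ≠ ⊤ := by
    refine measure_ne_top_of_subset inter_subset_left ?_
    rw [Measure.volume_eq_prod, Measure.prod_prod]
    exact ENNReal.mul_ne_top hf hf'
  set F : Finset ℤ := Finset.Icc ⌊-N⌋ ⌊N⌋ with hF
  have hmemF : ∀ x ∈ Icc (-N) N, ⌊x⌋ ∈ F := fun x hx =>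
    Finset.mem_Icc.2 ⟨Int.floor_le_floor hx.1, Int.floor_le_floor hx.2⟩
  refine (hL V hVm hVf F (fun z hz => hmemF _ (hN hz.1.1).1) (fun z hz => hpW0_O hz.2.1)
    (fun z hz => hmemF _ (hN hz.1.1).2) (fun z hz => hpW0_O hz.2.2)).trans ?_
  rw [mul_assoc]
  refine mul_le_mul_right ?_ _
  have hterm : ∀ o₁ ∈ hpO, ∀ o₂ ∈ hpO, ∀ m₁ m₂ : ℤ,
      ∫⁻ p, ‖hpT (V ∩ hpZ1 o₁ m₁ ∩ hpZ2 o₂ m₂) p‖ₑ ^ s ≤ ENNReal.ofReal A ^ s *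
      (volume (Ω ∩ hpSq m₁ m₂) * volume (Ω' ∩ hpSq (m₁ + o₁) (m₂ + o₂))) ^ (s / r0) := by
    intro o₁ ho₁ o₂ ho₂ m₁ m₂
    by_cases hne : (V ∩ hpZ1 o₁ m₁ ∩ hpZ2 o₂ m₂).Nonempty
    · have e : V ∩ hpZ1 o₁ m₁ ∩ hpZ2 o₂ m₂ =
          (Ω ∩ hpSq m₁ m₂) ×ˢ (Ω' ∩ hpSq (m₁ + o₁) (m₂ + o₂)) := by
        obtain ⟨z0, ⟨⟨-, h1, h2⟩, h3, h4⟩, h5, h6⟩ := hne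
        simp only [hpW0, mem_ofPred_eq] at h1 h2
        rw [h3, h4] at h1
        rw [h5, h6] at h2
        ext z
        constructor
        · rintro ⟨⟨⟨⟨a1, a2⟩, -⟩, a3, a4⟩, a5, a6⟩
          exact ⟨⟨a1, a3, a5⟩, a2, a4, a6⟩
        · rintro ⟨⟨a1, a3, a5⟩, a2, a4, a6⟩
          refine ⟨⟨⟨⟨a1, a2⟩, ?_, ?_⟩, a3, a4⟩, a5, a6⟩
          · simp only [hpW0, mem_ofPred_eq]; rw [a3, a4]; exact h1
          · simp only [hpW0, mem_ofPred_eq]; rw [a5, a6]; exact h2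
      rw [e]
      have h := hp_BH hr0 hr hBH m₁ m₂ o₁ o₂ ho₁ ho₂ (Ω ∩ hpSq m₁ m₂)
        (Ω' ∩ hpSq (m₁ + o₁) (m₂ + o₂)) (hΩ.inter (hpSq_meas _ _)) (hΩ'.inter (hpSq_meas _ _))
        inter_subset_right inter_subset_right
      rw [eLpNorm_eq_lintegral_rpow_enorm_toReal (by simp; linarith) ENNReal.ofReal_ne_top,
        ENNReal.toReal_ofReal (by linarith)] at h
      have h2 := ENNReal.rpow_le_rpow h (by linarith : 0 ≤ s)
      rw [← ENNReal.rpow_mul, one_div_mul_cancel (by linarith), ENNReal.rpow_one,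
        ENNReal.mul_rpow_of_nonneg _ _ (by linarith), ← ENNReal.rpow_mul] at h2
      rwa [one_div_mul_eq_div] at h2
    · rw [not_nonempty_iff_eq_empty.1 hne]
      simp [hpT, ENNReal.zero_rpow_of_pos (by linarith : 0 < s)]
  have hsum : ∀ o₁ ∈ hpO, ∀ o₂ ∈ hpO, ∑ m₁ ∈ F, ∑ m₂ ∈ F,
      ∫⁻ p, ‖hpT (V ∩ hpZ1 o₁ m₁ ∩ hpZ2 o₂ m₂) p‖ₑ ^ s ≤ ENNReal.ofReal A ^ s *
      ((D * D') ^ (s / r0 - 1 / 2) * (volume Ω * volume Ω') ^ (1 / 2 : ℝ)) := by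
    intro o₁ ho₁ o₂ ho₂
    refine (Finset.sum_le_sum fun m₁ _ => Finset.sum_le_sum fun m₂ _ =>
      hterm o₁ ho₁ o₂ ho₂ m₁ m₂).trans ?_
    simp_rw [← Finset.mul_sum]
    refine mul_le_mul_right ?_ _
    rw [← Finset.sum_product' F F (f := fun m₁ m₂ => (volume (Ω ∩ hpSq m₁ m₂) *
      volume (Ω' ∩ hpSq (m₁ + o₁) (m₂ + o₂))) ^ (s / r0))]
    refine hp_cs (F ×ˢ F) (fun m => volume (Ω ∩ hpSq m.1 m.2))
      (fun m => volume (Ω' ∩ hpSq (m.1 + o₁) (m.2 + o₂))) hsr ?_ (hp_sum_vol _ Ω' hΩ' o₁ o₂)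
      (fun m => hD _ _) (fun m => hD' _ _)
    simpa using hp_sum_vol (F ×ˢ F) Ω hΩ 0 0
  have hcard : hpO.card = 4 := by decide
  calc _ = ∑ o₁ ∈ hpO, ∑ o₂ ∈ hpO, ∑ m₁ ∈ F, ∑ m₂ ∈ F,
      ∫⁻ p, ‖hpT (V ∩ hpZ1 o₁ m₁ ∩ hpZ2 o₂ m₂) p‖ₑ ^ s := by
        refine Finset.sum_congr rfl fun o₁ _ => ?_
        rw [Finset.sum_comm]
    _ ≤ ∑ o₁ ∈ hpO, ∑ o₂ ∈ hpO, ENNReal.ofReal A ^ s *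
      ((D * D') ^ (s / r0 - 1 / 2) * (volume Ω * volume Ω') ^ (1 / 2 : ℝ)) :=
        Finset.sum_le_sum fun o₁ h₁ => Finset.sum_le_sum fun o₂ h₂ => hsum o₁ h₁ o₂ h₂
    _ = _ := by
        simp only [Finset.sum_const, hcard, nsmul_eq_mul]
        push_cast; ring


lemma hp_map_prod {α β : Type*} [MeasurableSpace α] [MeasurableSpace β] {μ : Measure α}
    {ν : Measure β} [SigmaFinite μ] [SigmaFinite ν] {f : α → α} {g : β → β} (hf : Measurable f)
    (hg : Measurable g) {c d : ℝ} (h1 : Measure.map f μ = ENNReal.ofReal c • μ)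
    (h2 : Measure.map g ν = ENNReal.ofReal d • ν) (hc : 0 ≤ c) :
    Measure.map (Prod.map f g) (μ.prod ν) = ENNReal.ofReal (c * d) • (μ.prod ν) := by
  rw [← Measure.map_prod_map _ _ hf hg, h1, h2, Measure.prod_smul_left, Measure.prod_smul_right,
    smul_smul, ENNReal.ofReal_mul hc]

lemma hp_map1 {a : ℝ} (ha : 0 < a) :
    Measure.map (fun x : ℝ => a * x) volume = ENNReal.ofReal a⁻¹ • volume := by
  rw [Real.map_volume_mul_left ha.ne', abs_of_pos (inv_pos.2 ha)]

noncomputable def hpD (a b : ℝ) (ξ : ℝ × ℝ) : ℝ × ℝ := Prod.map (fun x => a * x) (fun x => b * x) ξ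

lemma hpD_meas (a b : ℝ) : Measurable (hpD a b) := by unfold hpD; fun_prop

lemma hpD_map {a b : ℝ} (ha : 0 < a) (hb : 0 < b) :
    Measure.map (hpD a b) volume = ENNReal.ofReal (a⁻¹ * b⁻¹) • volume :=
  hp_map_prod (by fun_prop) (by fun_prop) (hp_map1 ha) (hp_map1 hb) (by positivity)

lemma hpD_vol {a b : ℝ} (ha : 0 < a) (hb : 0 < b) (Ω : Set (ℝ × ℝ)) (hΩ : MeasurableSet Ω) :
    volume (hpD a b ⁻¹' Ω) = ENNReal.ofReal (a * b)⁻¹ * volume Ω := by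
  rw [← Measure.map_apply (hpD_meas a b) hΩ, hpD_map ha hb, mul_inv]; simp

lemma hpD_map4 {a b : ℝ} (ha : 0 < a) (hb : 0 < b) :
    Measure.map (Prod.map (hpD a b) (hpD a b)) volume =
      ENNReal.ofReal ((a⁻¹ * b⁻¹) * (a⁻¹ * b⁻¹)) • volume :=
  hp_map_prod (hpD_meas a b) (hpD_meas a b) (hpD_map ha hb) (hpD_map ha hb) (by positivity)

noncomputable def hpD3 (a b : ℝ) (p : ℝ × ℝ × ℝ) : ℝ × ℝ × ℝ :=
  Prod.map (fun x => (a * b) * x) (hpD a b) p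

lemma hpD3_map {a b : ℝ} (ha : 0 < a) (hb : 0 < b) :
    Measure.map (hpD3 a b) volume = ENNReal.ofReal ((a * b)⁻¹ * (a⁻¹ * b⁻¹)) • volume :=
  hp_map_prod (by fun_prop) (hpD_meas a b) (hp_map1 (mul_pos ha hb)) (hpD_map ha hb) (by positivity)

/-- The Whitney region at scale `(a,b)`. -/
def hpWs (a b : ℝ) : Set ((ℝ × ℝ) × (ℝ × ℝ)) :=
  {z | (a⁻¹ * z.1.1, a⁻¹ * z.2.1) ∈ hpW0 ∧ (b⁻¹ * z.1.2, b⁻¹ * z.2.2) ∈ hpW0}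

lemma hpWs_meas (a b : ℝ) : MeasurableSet (hpWs a b) := by
  have h1 : Measurable fun z : (ℝ × ℝ) × (ℝ × ℝ) => (a⁻¹ * z.1.1, a⁻¹ * z.2.1) := by fun_prop
  have h2 : Measurable fun z : (ℝ × ℝ) × (ℝ × ℝ) => (b⁻¹ * z.1.2, b⁻¹ * z.2.2) := by fun_prop
  exact (h1 hpW0_meas).inter (h2 hpW0_meas)

def hpRect (a b : ℝ) (m₁ m₂ : ℤ) : Set (ℝ × ℝ) := {ξ | ⌊a⁻¹ * ξ.1⌋ = m₁ ∧ ⌊b⁻¹ * ξ.2⌋ = m₂}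

lemma hpRect_meas (a b : ℝ) (m₁ m₂ : ℤ) : MeasurableSet (hpRect a b m₁ m₂) := by
  have h1 : Measurable fun z : ℝ × ℝ => ⌊a⁻¹ * z.1⌋ := by fun_prop
  have h2 : Measurable fun z : ℝ × ℝ => ⌊b⁻¹ * z.2⌋ := by fun_prop
  exact (h1 (measurableSet_singleton m₁)).inter (h2 (measurableSet_singleton m₂))

lemma hpT_scale {a b : ℝ} (ha : 0 < a) (hb : 0 < b) (Ω Ω' : Set (ℝ × ℝ)) (hΩ : MeasurableSet Ω)
    (hΩ' : MeasurableSet Ω') (p : ℝ × ℝ × ℝ) :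
    hpT ((Ω ×ˢ Ω') ∩ hpWs a b) p = (((a * b) ^ 2 : ℝ) : ℂ) *
      hpT (((hpD a b ⁻¹' Ω) ×ˢ (hpD a b ⁻¹' Ω')) ∩ hpWW) (hpD3 a b p) := by
  have hM : Measurable (Prod.map (hpD a b) (hpD a b)) := (hpD_meas a b).prodMap (hpD_meas a b)
  have hset : (((hpD a b ⁻¹' Ω) ×ˢ (hpD a b ⁻¹' Ω')) ∩ hpWW) =
      Prod.map (hpD a b) (hpD a b) ⁻¹' ((Ω ×ˢ Ω') ∩ hpWs a b) := by
    ext z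
    simp only [hpWs, hpWW, mem_inter_iff, mem_prod, mem_preimage, mem_ofPred_eq, Prod.map_fst,
      Prod.map_snd, hpD, inv_mul_cancel_left₀ ha.ne', inv_mul_cancel_left₀ hb.ne']
  have hph : ∀ z : (ℝ × ℝ) × (ℝ × ℝ), hpPh (hpD3 a b p) z.1 * hpPh (hpD3 a b p) z.2 =
      (fun y : (ℝ × ℝ) × (ℝ × ℝ) => hpPh p y.1 * hpPh p y.2) (Prod.map (hpD a b) (hpD a b) z) := by
    intro z
    simp only [hpPh, hpD3, hpD, Prod.map_fst, Prod.map_snd]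
    congr 2 <;> (congr 2; ring)
  have hm := hpPh_meas1 p
  unfold hpT
  rw [hset]
  have hmap := setIntegral_map (μ := volume) (f := fun y : (ℝ × ℝ) × (ℝ × ℝ) => hpPh p y.1 * hpPh p y.2)
    (g := Prod.map (hpD a b) (hpD a b)) ((hΩ.prod hΩ').inter (hpWs_meas a b))
    (by fun_prop) hM.aemeasurable
  rw [integral_congr_ae (ae_of_all _ hph), ← hmap, hpD_map4 ha hb, Measure.restrict_smul, integral_smul_measure, ENNReal.toReal_ofReal (by positivity),
    Complex.real_smul, ← mul_assoc, ← Complex.ofReal_mul]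
  have : (a * b) ^ 2 * (a⁻¹ * b⁻¹ * (a⁻¹ * b⁻¹)) = 1 := by field_simp
  rw [this]; simp

lemma hp_scaled {s r A r0 : ℝ} (hs1 : 1 < s) (hs2 : s < 2) (hr0 : 0 < r0) (hr : r < r0)
    (hsr : 1 / 2 ≤ s / r0) (hBH : BH s r A) :
    ∃ B : ℝ≥0∞, B ≠ ⊤ ∧ ∀ Ω Ω' : Set (ℝ × ℝ), MeasurableSet Ω → MeasurableSet Ω' →
      volume Ω ≠ ⊤ → volume Ω' ≠ ⊤ → ∀ N : ℝ, Ω ⊆ Icc (-N) N ×ˢ Icc (-N) N →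
      ∀ a b : ℝ, 0 < a → 0 < b →
      ∀ D D' : ℝ≥0∞, (∀ m₁ m₂, volume (Ω ∩ hpRect a b m₁ m₂) ≤ D) →
        (∀ m₁ m₂, volume (Ω' ∩ hpRect a b m₁ m₂) ≤ D') →
      ∫⁻ p, ‖hpT ((Ω ×ˢ Ω') ∩ hpWs a b) p‖ₑ ^ s ≤
        B * (ENNReal.ofReal (a * b) ^ (2 * s - 2 - 2 * (s / r0)) *
          ((D * D') ^ (s / r0 - 1 / 2) * (volume Ω * volume Ω') ^ (1 / 2 : ℝ))) := by
  obtain ⟨B, hB, hL⟩ := hp_unit hs1 hs2 hr0 hr hsr hBH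
  refine ⟨B, hB, ?_⟩
  intro Ω Ω' hΩ hΩ' hf hf' N hN a b ha hb D D' hD hD'
  have hab : 0 < a * b := mul_pos ha hb
  set κ := ENNReal.ofReal (a * b) with hκ
  have hκ0 : κ ≠ 0 := by simpa [hκ] using hab
  have hκt : κ ≠ ⊤ := ENNReal.ofReal_ne_top
  have hinv : ENNReal.ofReal (a * b)⁻¹ = κ⁻¹ := ENNReal.ofReal_inv_of_pos hab
  have hsq : ∀ X : Set (ℝ × ℝ), ∀ m₁ m₂, hpD a b ⁻¹' X ∩ hpSq m₁ m₂ =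
      hpD a b ⁻¹' (X ∩ hpRect a b m₁ m₂) := by
    intro X m₁ m₂
    ext z
    simp only [hpSq, hpRect, mem_inter_iff, mem_preimage, mem_ofPred_eq, Prod.map_fst,
      Prod.map_snd, hpD, inv_mul_cancel_left₀ ha.ne', inv_mul_cancel_left₀ hb.ne']
  have hvol : ∀ X : Set (ℝ × ℝ), MeasurableSet X → volume (hpD a b ⁻¹' X) = κ⁻¹ * volume X := by
    intro X hX; rw [hpD_vol ha hb X hX, hinv]
  have h1 := hL (hpD a b ⁻¹' Ω) (hpD a b ⁻¹' Ω') (hpD_meas a b hΩ) (hpD_meas a b hΩ')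
    (by rw [hvol _ hΩ]; exact ENNReal.mul_ne_top (ENNReal.inv_ne_top.2 hκ0) hf)
    (by rw [hvol _ hΩ']; exact ENNReal.mul_ne_top (ENNReal.inv_ne_top.2 hκ0) hf')
    (N / a + N / b) (by
      rintro ⟨x, y⟩ hz
      have h := hN hz
      simp only [hpD, Prod.map_apply, mem_prod, mem_Icc] at h
      obtain ⟨⟨h1, h2⟩, h3, h4⟩ := h
      have hN0 : 0 ≤ N := by linarith
      have e1 : 0 ≤ N / a := by positivity
      have e2 : 0 ≤ N / b := by positivity
      have e3 : -(N / a) ≤ x := by rw [neg_le, div_eq_inv_mul, le_inv_mul_iff₀ ha]; linarith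
      have e4 : x ≤ N / a := by rw [le_div_iff₀ ha]; linarith
      have e5 : -(N / b) ≤ y := by rw [neg_le, div_eq_inv_mul, le_inv_mul_iff₀ hb]; linarith
      have e6 : y ≤ N / b := by rw [le_div_iff₀ hb]; linarith
      refine ⟨⟨?_, ?_⟩, ?_, ?_⟩ <;> simp only <;> linarith)
    (κ⁻¹ * D) (κ⁻¹ * D')
    (fun m₁ m₂ => by
      rw [hsq, hvol _ (hΩ.inter (hpRect_meas _ _ _ _))]; gcongr; exact hD _ _)
    (fun m₁ m₂ => by
      rw [hsq, hvol _ (hΩ'.inter (hpRect_meas _ _ _ _))]; gcongr; exact hD' _ _)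
  rw [hvol _ hΩ, hvol _ hΩ'] at h1
  set T0 := hpT (((hpD a b ⁻¹' Ω) ×ˢ (hpD a b ⁻¹' Ω')) ∩ hpWW) with hT0
  have hT0m : Measurable fun p => ‖T0 p‖ₑ ^ s := (hpT_meas _).enorm.pow_const s
  have hD3m : Measurable (hpD3 a b) := by unfold hpD3 hpD; fun_prop
  have h2 : ∫⁻ p, ‖hpT ((Ω ×ˢ Ω') ∩ hpWs a b) p‖ₑ ^ s = κ ^ (2 * s - 2) * ∫⁻ p, ‖T0 p‖ₑ ^ s := by
    have e1 : ∀ p, ‖(((a * b) ^ 2 : ℝ) : ℂ) * T0 (hpD3 a b p)‖ₑ ^ s =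
        κ ^ (2 * s) * ‖T0 (hpD3 a b p)‖ₑ ^ s := by
      intro p
      rw [enorm_mul, ENNReal.mul_rpow_of_nonneg _ _ (by linarith), ← ofReal_norm,
        Complex.norm_real, Real.norm_of_nonneg (by positivity), ENNReal.ofReal_pow hab.le,
        ← ENNReal.rpow_natCast, ← ENNReal.rpow_mul]
      norm_num [hκ]
    have e0 : ∀ p, ‖hpT ((Ω ×ˢ Ω') ∩ hpWs a b) p‖ₑ ^ s = κ ^ (2 * s) * ‖T0 (hpD3 a b p)‖ₑ ^ s := by
      intro p
      rw [hpT_scale ha hb Ω Ω' hΩ hΩ', ← e1]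
    have e3 := lintegral_map (μ := volume) hT0m hD3m
    rw [lintegral_congr e0, lintegral_const_mul' _ _ (ENNReal.rpow_ne_top_of_nonneg (by linarith) hκt),
      ← e3, hpD3_map ha hb,
      lintegral_smul_measure, smul_eq_mul, ← mul_assoc]
    congr 1
    rw [← mul_inv, ENNReal.ofReal_mul (by positivity), hinv, sub_eq_add_neg,
      ENNReal.rpow_add _ _ hκ0 hκt, ENNReal.rpow_neg]
    congr 1
    rw [show (2 : ℝ) = ((2 : ℕ) : ℝ) by norm_num, ENNReal.rpow_natCast, ENNReal.inv_pow, sq]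
  rw [h2]
  calc _ ≤ κ ^ (2 * s - 2) * (B * ((κ⁻¹ * D * (κ⁻¹ * D')) ^ (s / r0 - 1 / 2) *
        (κ⁻¹ * volume Ω * (κ⁻¹ * volume Ω')) ^ (1 / 2 : ℝ))) := by gcongr
    _ = _ := by
      have e1 : ∀ x y : ℝ≥0∞, κ⁻¹ * x * (κ⁻¹ * y) = κ ^ (-2 : ℝ) * (x * y) := by
        intro x y
        rw [ENNReal.rpow_neg, show (2 : ℝ) = ((2 : ℕ) : ℝ) by norm_num, ENNReal.rpow_natCast,
          ENNReal.inv_pow]; ring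
      rw [e1, e1, ENNReal.mul_rpow_of_nonneg _ _ (by linarith : 0 ≤ s / r0 - 1 / 2),
        ENNReal.mul_rpow_of_nonneg _ _ (by norm_num : (0:ℝ) ≤ 1 / 2), ← ENNReal.rpow_mul,
        ← ENNReal.rpow_mul]
      have e2 : κ ^ (2 * s - 2 - 2 * (s / r0)) = κ ^ (2 * s - 2) * κ ^ (-2 * (s / r0 - 1 / 2)) *
          κ ^ (-2 * (1 / 2 : ℝ)) := by
        rw [← ENNReal.rpow_add _ _ hκ0 hκt, ← ENNReal.rpow_add _ _ hκ0 hκt]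
        congr 1; ring
      rw [e2]; ring


lemma hp_floor_half (x : ℝ) : ⌊2 * x⌋ / 2 = ⌊x⌋ := by
  have h1 := Int.floor_le x
  have h2 := Int.lt_floor_add_one x
  have h3 : 2 * ⌊x⌋ ≤ ⌊2 * x⌋ := by rw [Int.le_floor]; push_cast; linarith
  have h4 : ⌊2 * x⌋ < 2 * ⌊x⌋ + 2 := by rw [Int.floor_lt]; push_cast; linarith
  omega

lemma hp_zp (j : ℤ) (x : ℝ) : (2 : ℝ) ^ j * x = 2 * ((2 : ℝ) ^ (j - 1) * x) := by
  rw [show j = (j - 1) + 1 by ring, zpow_add_one₀ (by norm_num)]; simp; ring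

lemma hp_zlarge (x : ℝ) (hx : 0 < x) : ∃ j : ℤ, 3 ≤ (2 : ℝ) ^ j * x := by
  obtain ⟨n, hn⟩ := pow_unbounded_of_one_lt (3 / x) (by norm_num : (1:ℝ) < 2)
  refine ⟨n, ?_⟩
  rw [zpow_natCast]
  rw [div_lt_iff₀ hx] at hn
  exact hn.le

lemma hp_zsmall (x : ℝ) (hx : 0 < x) : ∃ j : ℤ, ∀ i ≤ j, (2 : ℝ) ^ i * x ≤ 1 := by
  obtain ⟨n, hn⟩ := pow_unbounded_of_one_lt x (by norm_num : (1:ℝ) < 2)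
  refine ⟨-n, fun i hi => ?_⟩
  calc (2 : ℝ) ^ i * x ≤ (2 : ℝ) ^ (-(n : ℤ)) * x := by
        gcongr; norm_num
    _ ≤ 1 := by
        rw [zpow_neg, zpow_natCast, inv_mul_le_iff₀ (by positivity)]; linarith

lemma hp_whit {x y : ℝ} (hxy : x ≠ y) : ∃! j : ℤ, ((2 : ℝ) ^ j * x, (2 : ℝ) ^ j * y) ∈ hpW0 := by
  set P : ℤ → Prop := fun j => 2 ≤ |⌊(2 : ℝ) ^ j * x⌋ - ⌊(2 : ℝ) ^ j * y⌋| with hP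
  have hW : ∀ j, ((2 : ℝ) ^ j * x, (2 : ℝ) ^ j * y) ∈ hpW0 ↔ P j ∧ ¬ P (j - 1) := by
    intro j
    simp only [hpW0, mem_ofPred_eq, hP]
    rw [hp_zp j x, hp_zp j y, hp_floor_half, hp_floor_half]
    constructor <;> rintro ⟨h1, h2⟩ <;> refine ⟨h1, by omega⟩
  have hmono1 : ∀ j, P (j - 1) → P j := by
    intro j h
    simp only [hP] at h ⊢
    rw [← hp_floor_half ((2 : ℝ) ^ (j - 1) * x), ← hp_floor_half ((2 : ℝ) ^ (j - 1) * y), ← hp_zp,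
      ← hp_zp, le_abs] at h
    rw [le_abs]
    omega
  have hmono : ∀ j i, j ≤ i → P j → P i := by
    intro j i hji
    induction i, hji using Int.leInduction with
    | base => exact id
    | succ n hn ih => intro h; exact hmono1 (n + 1) (by simpa using ih h)
  have hd : 0 < |x - y| := abs_pos.2 (sub_ne_zero.2 hxy)
  have hab : ∀ j : ℤ, (2 : ℝ) ^ j * |x - y| = |(2 : ℝ) ^ j * x - (2 : ℝ) ^ j * y| := by
    intro j
    rw [← mul_sub, abs_mul, abs_of_pos (by positivity : (0:ℝ) < 2 ^ j)]
  have hfl : ∀ u v : ℝ, |u - v| < |((⌊u⌋ - ⌊v⌋ : ℤ) : ℝ)| + 1 ∧ |((⌊u⌋ - ⌊v⌋ : ℤ) : ℝ)| < |u - v| + 1 := by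
    intro u v
    have h1 := Int.floor_le u
    have h2 := Int.lt_floor_add_one u
    have h3 := Int.floor_le v
    have h4 := Int.lt_floor_add_one v
    push_cast
    constructor
    · rw [abs_lt]; constructor
      · linarith [neg_abs_le ((⌊u⌋ : ℝ) - ⌊v⌋)]
      · linarith [le_abs_self ((⌊u⌋ : ℝ) - ⌊v⌋)]
    · rw [abs_lt]; constructor
      · linarith [neg_abs_le (u - v)]
      · linarith [le_abs_self (u - v)]
  have hlarge : ∃ j, P j := by
    obtain ⟨j, hj⟩ := hp_zlarge _ hd
    refine ⟨j, ?_⟩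
    rw [hab] at hj
    have := (hfl ((2 : ℝ) ^ j * x) ((2 : ℝ) ^ j * y)).1
    have h2 : (2 : ℝ) < |((⌊(2 : ℝ) ^ j * x⌋ - ⌊(2 : ℝ) ^ j * y⌋ : ℤ) : ℝ)| := by linarith
    rw [← Int.cast_abs] at h2
    have h3 : (2 : ℤ) < |⌊(2 : ℝ) ^ j * x⌋ - ⌊(2 : ℝ) ^ j * y⌋| := by exact_mod_cast h2
    exact h3.le
  have hsmall : ∃ b : ℤ, ∀ z, P z → b ≤ z := by
    obtain ⟨j, hj⟩ := hp_zsmall _ hd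
    refine ⟨j, fun z hz => ?_⟩
    by_contra hlt
    push Not at hlt
    have h := hj z hlt.le
    rw [hab] at h
    have := (hfl ((2 : ℝ) ^ z * x) ((2 : ℝ) ^ z * y)).2
    have h2 : |((⌊(2 : ℝ) ^ z * x⌋ - ⌊(2 : ℝ) ^ z * y⌋ : ℤ) : ℝ)| < 2 := by linarith
    rw [← Int.cast_abs] at h2
    have h3 : |⌊(2 : ℝ) ^ z * x⌋ - ⌊(2 : ℝ) ^ z * y⌋| < 2 := by exact_mod_cast h2
    simp only [hP] at hz
    omega
  obtain ⟨j, hj, hjm⟩ := Int.exists_least_of_bdd hsmall hlarge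
  refine ⟨j, (hW j).2 ⟨hj, fun h => by have := hjm _ h; omega⟩, ?_⟩
  intro i hi
  obtain ⟨h1, h2⟩ := (hW i).1 hi
  have h3 := hjm i h1
  by_contra hne
  exact h2 (hmono j (i - 1) (by omega) hj)

/-- dyadic Whitney pieces -/
def hpWj (n : ℤ × ℤ) : Set ((ℝ × ℝ) × (ℝ × ℝ)) := hpWs ((2 : ℝ) ^ (-n.1)) ((2 : ℝ) ^ (-n.2))

lemma hpWj_disj : Pairwise (Function.onFun Disjoint hpWj) := by
  intro n m hnm
  rw [Function.onFun, Set.disjoint_left]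
  intro z hz hz'
  simp only [hpWj, hpWs, mem_ofPred_eq, zpow_neg, inv_inv] at hz hz'
  have hne : ∀ u v : ℝ, ∀ j : ℤ, ((2 : ℝ) ^ j * u, (2 : ℝ) ^ j * v) ∈ hpW0 → u ≠ v := by
    rintro u v j h rfl
    simp [hpW0] at h
  apply hnm
  ext
  · exact (hp_whit (hne _ _ _ hz.1)).unique hz.1 hz'.1
  · exact (hp_whit (hne _ _ _ hz.2)).unique hz.2 hz'.2

lemma hpWj_union : ∀ᵐ z : (ℝ × ℝ) × (ℝ × ℝ), z ∈ ⋃ n, hpWj n := by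
  have key : ∀ᵐ z : (ℝ × ℝ) × (ℝ × ℝ), z.1.1 ≠ z.2.1 ∧ z.1.2 ≠ z.2.2 := by
    have hm : MeasurableSet {z : (ℝ × ℝ) × (ℝ × ℝ) | z.1.1 ≠ z.2.1 ∧ z.1.2 ≠ z.2.2} := by
      apply MeasurableSet.inter
      · exact (measurableSet_eq_fun (by fun_prop) (by fun_prop)).compl
      · exact (measurableSet_eq_fun (by fun_prop) (by fun_prop)).compl
    have : (volume : Measure ((ℝ × ℝ) × (ℝ × ℝ))) = (volume : Measure (ℝ × ℝ)).prod volume := rfl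
    rw [this, Measure.ae_prod_iff_ae_ae hm]
    refine ae_of_all _ fun ξ => ?_
    have : (volume : Measure (ℝ × ℝ)) = (volume : Measure ℝ).prod volume := rfl
    rw [this, Measure.ae_prod_iff_ae_ae]
    · have h1 : ∀ᵐ x : ℝ, x ≠ ξ.1 := by simp [ae_iff]
      have h2 : ∀ᵐ x : ℝ, x ≠ ξ.2 := by simp [ae_iff]
      filter_upwards [h1] with x hx
      filter_upwards [h2] with y hy
      exact ⟨hx.symm, hy.symm⟩
    · apply MeasurableSet.inter
      · exact (measurableSet_eq_fun (by fun_prop) (by fun_prop)).compl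
      · exact (measurableSet_eq_fun (by fun_prop) (by fun_prop)).compl
  filter_upwards [key] with z hz
  obtain ⟨j, hj, -⟩ := hp_whit hz.1
  obtain ⟨k, hk, -⟩ := hp_whit hz.2
  refine mem_iUnion.2 ⟨(j, k), ?_⟩
  simp only [hpWj, hpWs, mem_ofPred_eq, zpow_neg, inv_inv]
  exact ⟨hj, hk⟩

lemma hpT_hasSum (Ω Ω' : Set (ℝ × ℝ)) (hΩ : MeasurableSet Ω) (hΩ' : MeasurableSet Ω')
    (hf : volume Ω ≠ ⊤) (hf' : volume Ω' ≠ ⊤) (p : ℝ × ℝ × ℝ) :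
    HasSum (fun n => hpT ((Ω ×ˢ Ω') ∩ hpWj n) p) (hpT (Ω ×ˢ Ω') p) := by
  have hfin : volume (Ω ×ˢ Ω') ≠ ⊤ := by
    rw [Measure.volume_eq_prod, Measure.prod_prod]; exact ENNReal.mul_ne_top hf hf'
  have heq : hpT (Ω ×ˢ Ω') p = hpT (⋃ n, (Ω ×ˢ Ω') ∩ hpWj n) p := by
    unfold hpT
    apply setIntegral_congr_set
    filter_upwards [hpWj_union] with z hz
    rw [← inter_iUnion]
    apply propext
    exact ⟨fun h => ⟨h, hz⟩, fun h => h.1⟩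
  rw [heq]
  unfold hpT
  apply hasSum_integral_iUnion
  · intro n; exact (hΩ.prod hΩ').inter (hpWs_meas _ _)
  · intro n m hnm
    exact (hpWj_disj hnm).mono inter_subset_right inter_subset_right
  · exact (hpT_int _ hfin p).mono_set (iUnion_subset fun n => inter_subset_left)

/-- Countable Minkowski. -/
lemma hp_mink {ι : Type*} [Countable ι] {s : ℝ} (hs : 1 ≤ s) (F : ι → ℝ × ℝ × ℝ → ℂ)
    (hF : ∀ n, Measurable (F n)) (G : ℝ × ℝ × ℝ → ℂ) (hG : ∀ p, HasSum (fun n => F n p) (G p)) :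
    (∫⁻ p, ‖G p‖ₑ ^ s) ^ (1 / s) ≤ ∑' n, (∫⁻ p, ‖F n p‖ₑ ^ s) ^ (1 / s) := by
  have hs0 : 0 < s := by linarith
  have h1 : ∀ (S : Finset ι), (∫⁻ p, ‖∑ n ∈ S, F n p‖ₑ ^ s) ^ (1 / s) ≤
      ∑' n, (∫⁻ p, ‖F n p‖ₑ ^ s) ^ (1 / s) := by
    intro S
    have hp0 : ENNReal.ofReal s ≠ 0 := by simpa using hs0
    have := eLpNorm_sum_le (μ := volume) (p := ENNReal.ofReal s) (f := F) (s := S)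
      (fun i _ => (hF i).aestronglyMeasurable) (by simpa using hs)
    simp only [eLpNorm_eq_lintegral_rpow_enorm_toReal hp0 ENNReal.ofReal_ne_top,
      ENNReal.toReal_ofReal hs0.le, Finset.sum_apply] at this
    exact this.trans (ENNReal.sum_le_tsum S)
  have hb : ∀ (S : Finset ι), ∫⁻ p, ‖∑ n ∈ S, F n p‖ₑ ^ s ≤
      (∑' n, (∫⁻ p, ‖F n p‖ₑ ^ s) ^ (1 / s)) ^ s := by
    intro S
    have := ENNReal.rpow_le_rpow (h1 S) hs0.le
    rwa [← ENNReal.rpow_mul, one_div_mul_cancel hs0.ne', ENNReal.rpow_one] at this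
  have h2 : ∫⁻ p, ‖G p‖ₑ ^ s ≤ (∑' n, (∫⁻ p, ‖F n p‖ₑ ^ s) ^ (1 / s)) ^ s := by
    have hlim : ∀ p, ‖G p‖ₑ ^ s = Filter.liminf (fun S : Finset ι => ‖∑ n ∈ S, F n p‖ₑ ^ s) Filter.atTop := by
      intro p
      have := (hG p).enorm.ennrpow_const s
      exact this.liminf_eq.symm
    rw [lintegral_congr hlim]
    refine (lintegral_liminf_le' (fun S => ?_)).trans ?_
    · exact ((Finset.measurable_sum S fun i _ => hF i).enorm.pow_const s).aemeasurable
    · exact Filter.liminf_le_of_le (by isBoundedDefault) (fun b hb' => by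
        obtain ⟨S, hS⟩ := hb'.exists
        exact hS.trans (hb S))
  have := ENNReal.rpow_le_rpow h2 (by positivity : 0 ≤ 1 / s)
  rwa [← ENNReal.rpow_mul, mul_one_div_cancel hs0.ne', ENNReal.rpow_one] at this


def hpFib (Ω : Set (ℝ × ℝ)) (μ K : ℤ) : Prop :=
  MeasurableSet Ω ∧ volume Ω ≠ ⊤ ∧ (∃ N : ℝ, Ω ⊆ Icc (-N) N ×ˢ Icc (-N) N) ∧
  (∀ a b : ℝ, 0 < a → 0 < b → ∀ m₁ m₂, volume (Ω ∩ hpRect a b m₁ m₂) ≤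
    ENNReal.ofReal (min ((2 : ℝ) ^ μ) a) * ENNReal.ofReal (min ((2 : ℝ) ^ K) b)) ∧
  ENNReal.ofReal ((2 : ℝ) ^ μ) * ENNReal.ofReal ((2 : ℝ) ^ K) ≤ 4 * volume Ω

lemma hp_oned {δ ε : ℝ} (hδ : 0 < δ) (hε : 0 < ε) (j μ : ℤ) :
    ENNReal.ofReal ((2 : ℝ) ^ (-j)) ^ (-δ) * ENNReal.ofReal (min ((2 : ℝ) ^ μ) (2 ^ (-j))) ^ (δ + ε) ≤
      ENNReal.ofReal ((2 : ℝ) ^ μ) ^ ε * ENNReal.ofReal ((2 : ℝ) ^ (-min δ ε)) ^ (j + μ).natAbs := by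
  have p1 : (0 : ℝ) < 2 ^ (-j) := by positivity
  have p2 : (0 : ℝ) < 2 ^ μ := by positivity
  have p3 : 0 < min ((2 : ℝ) ^ μ) (2 ^ (-j)) := lt_min p2 p1
  have p4 : (0 : ℝ) < 2 ^ (-min δ ε) := by positivity
  rw [ENNReal.ofReal_rpow_of_pos p1, ENNReal.ofReal_rpow_of_pos p2, ENNReal.ofReal_rpow_of_pos p3,
    ← ENNReal.ofReal_pow p4.le, ← ENNReal.ofReal_mul (by positivity), ← ENNReal.ofReal_mul (by positivity)]
  apply ENNReal.ofReal_le_ofReal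
  have e : ∀ (i : ℤ) (c : ℝ), ((2 : ℝ) ^ i) ^ c = 2 ^ (i * c) := by
    intro i c
    rw [Real.rpow_mul (by norm_num), Real.rpow_intCast]
  have h2 : (1 : ℝ) < 2 := by norm_num
  rw [← Real.rpow_natCast, ← Real.rpow_mul (by norm_num), e, e]
  have hn : (((j + μ).natAbs : ℕ) : ℝ) = |(j : ℝ) + μ| := by
    rw [Nat.cast_natAbs]; push_cast; rfl
  rw [hn]
  rcases le_total (-j) μ with h | h
  · rw [min_eq_right (zpow_le_zpow_right₀ h2.le h), e, ← Real.rpow_add (by norm_num),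
      ← Real.rpow_add (by norm_num)]
    apply Real.rpow_le_rpow_of_exponent_le h2.le
    have h' : 0 ≤ (j : ℝ) + μ := by exact_mod_cast (by omega : 0 ≤ j + μ)
    rw [abs_of_nonneg h']
    push_cast
    nlinarith [min_le_right δ ε]
  · rw [min_eq_left (zpow_le_zpow_right₀ h2.le h), e, ← Real.rpow_add (by norm_num),
      ← Real.rpow_add (by norm_num)]
    apply Real.rpow_le_rpow_of_exponent_le h2.le
    have h' : (j : ℝ) + μ ≤ 0 := by exact_mod_cast (by omega : j + μ ≤ 0)
    rw [abs_of_nonpos h']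
    push_cast
    nlinarith [min_le_left δ ε]

lemma hp_fib1 {s r A r0 : ℝ} (hs1 : 3 / 2 < s) (hs2 : s < 2) (hr0 : 0 < r0) (hr : r < r0)
    (hsr : s - 1 < s / r0) (hBH : BH s r A) :
    ∃ B θ : ℝ≥0∞, B ≠ ⊤ ∧ θ < 1 ∧ ∀ (Ω Ω' : Set (ℝ × ℝ)) (μ K μ' K' : ℤ), hpFib Ω μ K → hpFib Ω' μ' K' →
      ∀ n : ℤ × ℤ,
      ∫⁻ p, ‖hpT ((Ω ×ˢ Ω') ∩ hpWj n) p‖ₑ ^ s ≤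
        B * (volume Ω * volume Ω') ^ (s - 1) * θ ^ ((n.1 + μ).natAbs + (n.1 + μ').natAbs +
          (n.2 + K).natAbs + (n.2 + K').natAbs) := by
  obtain ⟨B, hB, hL⟩ := hp_scaled (by linarith) hs2 hr0 hr (by linarith) hBH
  set δ := s / r0 - (s - 1) with hδ
  set ε := s - 3 / 2 with hε
  have hδ0 : 0 < δ := by linarith
  have hε0 : 0 < ε := by linarith
  refine ⟨B * (4 ^ ε * 4 ^ ε), ENNReal.ofReal ((2 : ℝ) ^ (-min δ ε)), ?_, ?_, ?_⟩
  · have : (4 : ℝ≥0∞) ^ ε ≠ ⊤ := ENNReal.rpow_ne_top_of_nonneg hε0.le (by norm_num)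
    exact ENNReal.mul_ne_top hB (ENNReal.mul_ne_top this this)
  · rw [ENNReal.ofReal_lt_one]
    exact Real.rpow_lt_one_of_one_lt_of_neg (by norm_num) (by simp [hδ0, hε0])
  rintro Ω Ω' μ K μ' K' ⟨m, f, ⟨N, hN⟩, hD, hV⟩ ⟨m', f', -, hD', hV'⟩ ⟨j, k⟩
  have hj : (0 : ℝ) < 2 ^ (-j) := by positivity
  have hk : (0 : ℝ) < 2 ^ (-k) := by positivity
  have h1 := hL Ω Ω' m m' f f' N hN _ _ hj hk _ _ (hD _ _ hj hk) (hD' _ _ hj hk)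
  refine h1.trans ?_
  rw [mul_assoc B, mul_assoc B]
  refine mul_le_mul_right ?_ B
  have o1 := hp_oned hδ0 hε0 j μ
  have o2 := hp_oned hδ0 hε0 j μ'
  have o3 := hp_oned hδ0 hε0 k K
  have o4 := hp_oned hδ0 hε0 k K'
  set θ := ENNReal.ofReal ((2 : ℝ) ^ (-min δ ε))
  rw [ENNReal.ofReal_mul hj.le]
  set α := ENNReal.ofReal ((2 : ℝ) ^ (-j))
  set β := ENNReal.ofReal ((2 : ℝ) ^ (-k))
  set a1 := ENNReal.ofReal (min ((2 : ℝ) ^ μ) (2 ^ (-j)))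
  set a2 := ENNReal.ofReal (min ((2 : ℝ) ^ μ') (2 ^ (-j)))
  set a3 := ENNReal.ofReal (min ((2 : ℝ) ^ K) (2 ^ (-k)))
  set a4 := ENNReal.ofReal (min ((2 : ℝ) ^ K') (2 ^ (-k)))
  set u1 := ENNReal.ofReal ((2 : ℝ) ^ μ)
  set u2 := ENNReal.ofReal ((2 : ℝ) ^ μ')
  set u3 := ENNReal.ofReal ((2 : ℝ) ^ K)
  set u4 := ENNReal.ofReal ((2 : ℝ) ^ K')
  have hγ : s / r0 - 1 / 2 = δ + ε := by rw [hδ, hε]; ring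
  have hα0 : α ≠ 0 := by simpa [α] using hj
  have hαt : α ≠ ⊤ := ENNReal.ofReal_ne_top
  have hβ0 : β ≠ 0 := by simpa [β] using hk
  have hβt : β ≠ ⊤ := ENNReal.ofReal_ne_top
  have hγ0 : 0 ≤ δ + ε := by positivity
  have hex : 2 * s - 2 - 2 * (s / r0) = -δ + -δ := by rw [hδ]; ring
  set V := volume Ω
  set V' := volume Ω'
  calc (α * β) ^ (2 * s - 2 - 2 * (s / r0)) * ((a1 * a3 * (a2 * a4)) ^ (s / r0 - 1 / 2) *
        (V * V') ^ (1 / 2 : ℝ))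
      = (α ^ (-δ) * a1 ^ (δ + ε)) * (α ^ (-δ) * a2 ^ (δ + ε)) * (β ^ (-δ) * a3 ^ (δ + ε)) *
        (β ^ (-δ) * a4 ^ (δ + ε)) * (V * V') ^ (1 / 2 : ℝ) := by
        rw [hγ, hex, ENNReal.mul_rpow_of_ne_top hαt hβt, ENNReal.rpow_add _ _ hα0 hαt,
          ENNReal.rpow_add _ _ hβ0 hβt]
        simp only [ENNReal.mul_rpow_of_nonneg _ _ hγ0]
        ring
    _ ≤ (u1 ^ ε * θ ^ (j + μ).natAbs) * (u2 ^ ε * θ ^ (j + μ').natAbs) *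
        (u3 ^ ε * θ ^ (k + K).natAbs) * (u4 ^ ε * θ ^ (k + K').natAbs) * (V * V') ^ (1 / 2 : ℝ) := by
        gcongr
    _ = ((u1 * u3) ^ ε * (u2 * u4) ^ ε) * (V * V') ^ (1 / 2 : ℝ) *
        θ ^ ((j + μ).natAbs + (j + μ').natAbs + (k + K).natAbs + (k + K').natAbs) := by
        simp only [ENNReal.mul_rpow_of_nonneg _ _ hε0.le, pow_add]
        ring
    _ ≤ ((4 * V) ^ ε * (4 * V') ^ ε) * (V * V') ^ (1 / 2 : ℝ) *
        θ ^ ((j + μ).natAbs + (j + μ').natAbs + (k + K).natAbs + (k + K').natAbs) := by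
        gcongr
    _ = _ := by
        rw [show s - 1 = ε + 1 / 2 by rw [hε]; ring,
          ENNReal.rpow_add_of_nonneg _ _ hε0.le (by norm_num : (0:ℝ) ≤ 1 / 2)]
        simp only [ENNReal.mul_rpow_of_nonneg _ _ hε0.le]
        ring

lemma hp_tsum_geo {ρ : ℝ≥0∞} (hρ : ρ < 1) : ∑' j : ℤ, ρ ^ j.natAbs ≠ ⊤ := by
  have h : ∑' j : ℤ, ρ ^ j.natAbs ≤ ∑' n : ℕ, ρ ^ n + ∑' n : ℕ, ρ ^ (n + 1) := by
    rw [tsum_of_nat_of_neg_add_one ENNReal.summable ENNReal.summable]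
    apply le_of_eq
    congr 1
  refine ne_top_of_le_ne_top ?_ h
  have h1 : ∑' n : ℕ, ρ ^ n ≠ ⊤ := by
    rw [ENNReal.tsum_geometric]
    exact ENNReal.inv_ne_top.2 (tsub_pos_of_lt hρ).ne'
  refine ENNReal.add_ne_top.2 ⟨h1, ?_⟩
  simp_rw [pow_succ]
  rw [ENNReal.tsum_mul_right]
  exact ENNReal.mul_ne_top h1 (hρ.trans ENNReal.one_lt_top).ne

lemma hp_tsum_shift (ρ : ℝ≥0∞) (μ : ℤ) : ∑' j : ℤ, ρ ^ (j + μ).natAbs = ∑' j : ℤ, ρ ^ j.natAbs :=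
  (Equiv.addRight μ).tsum_eq (fun j : ℤ => ρ ^ j.natAbs)

lemma hp_pow_rpow (x : ℝ≥0∞) (n : ℕ) (t : ℝ) : (x ^ n) ^ t = (x ^ t) ^ n := by
  rw [← ENNReal.rpow_natCast, ← ENNReal.rpow_natCast, ← ENNReal.rpow_mul, ← ENNReal.rpow_mul,
    mul_comm t]

/-- The bilinear estimate for fibred sets. -/
lemma hp_fib {s r A r0 : ℝ} (hs1 : 3 / 2 < s) (hs2 : s < 2) (hr0 : 0 < r0) (hr : r < r0)
    (hsr : s - 1 < s / r0) (hBH : BH s r A) :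
    ∃ B ρ : ℝ≥0∞, B ≠ ⊤ ∧ ρ < 1 ∧ ∀ (Ω Ω' : Set (ℝ × ℝ)) (μ K μ' K' : ℤ), hpFib Ω μ K → hpFib Ω' μ' K' →
      ∫⁻ p, ‖extOp (chi Ω) p * extOp (chi Ω') p‖ₑ ^ s ≤
        B * (volume Ω * volume Ω') ^ (s - 1) * ρ ^ (K - K').natAbs := by
  obtain ⟨B, θ, hB, hθ, hL⟩ := hp_fib1 hs1 hs2 hr0 hr hsr hBH
  have hs0 : 0 < s := by linarith
  set ρ := θ ^ (1 / (2 * s)) with hρ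
  have hρ1 : ρ < 1 := ENNReal.rpow_lt_one hθ (by positivity)
  set S := ∑' j : ℤ, ρ ^ j.natAbs with hS
  have hSt : S ≠ ⊤ := hp_tsum_geo hρ1
  refine ⟨B * (S * S) ^ s, ρ ^ s, ENNReal.mul_ne_top hB
    (ENNReal.rpow_ne_top_of_nonneg hs0.le (ENNReal.mul_ne_top hSt hSt)),
    ENNReal.rpow_lt_one hρ1 hs0, ?_⟩
  intro Ω Ω' μ K μ' K' hF hF'
  have hsum := fun p => hpT_hasSum Ω Ω' hF.1 hF'.1 hF.2.1 hF'.2.1 p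
  have h1 := hp_mink (by linarith : 1 ≤ s) (fun n => hpT ((Ω ×ˢ Ω') ∩ hpWj n)) (fun n => hpT_meas _)
    (hpT (Ω ×ˢ Ω')) hsum
  set M := (B * (volume Ω * volume Ω') ^ (s - 1)) ^ (1 / s) with hM
  have hθρ : ∀ n : ℕ, (θ ^ n) ^ (1 / s) = ρ ^ (2 * n) := by
    intro n
    rw [hρ, ← ENNReal.rpow_natCast, ← ENNReal.rpow_natCast, ← ENNReal.rpow_mul, ← ENNReal.rpow_mul]
    congr 1; push_cast; field_simp
  have h2 : ∀ n : ℤ × ℤ, (∫⁻ p, ‖hpT ((Ω ×ˢ Ω') ∩ hpWj n) p‖ₑ ^ s) ^ (1 / s) ≤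
      M * ρ ^ (K - K').natAbs * (ρ ^ (n.1 + μ).natAbs * ρ ^ (n.2 + K).natAbs) := by
    intro n
    refine (ENNReal.rpow_le_rpow (hL Ω Ω' μ K μ' K' hF hF' n) (by positivity)).trans ?_
    rw [ENNReal.mul_rpow_of_nonneg _ _ (by positivity), hθρ, ← hM, mul_assoc, ← pow_add, ← pow_add]
    refine mul_le_mul_right (pow_le_pow_of_le_one (zero_le) hρ1.le ?_) M
    omega
  have h3 : (∫⁻ p, ‖hpT (Ω ×ˢ Ω') p‖ₑ ^ s) ^ (1 / s) ≤ M * ρ ^ (K - K').natAbs * (S * S) := by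
    refine h1.trans ((ENNReal.tsum_le_tsum h2).trans (le_of_eq ?_))
    rw [ENNReal.tsum_mul_left, ENNReal.tsum_prod (f := fun x y : ℤ => ρ ^ (x + μ).natAbs * ρ ^ (y + K).natAbs)]
    congr 1
    simp_rw [ENNReal.tsum_mul_left, ENNReal.tsum_mul_right]
    rw [hp_tsum_shift, hp_tsum_shift]
  have h4 := ENNReal.rpow_le_rpow h3 hs0.le
  rw [← ENNReal.rpow_mul, one_div_mul_cancel hs0.ne', ENNReal.rpow_one] at h4
  have h5 : ∀ p, ‖extOp (chi Ω) p * extOp (chi Ω') p‖ₑ ^ s = ‖hpT (Ω ×ˢ Ω') p‖ₑ ^ s := by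
    intro p
    rw [hp_ext_mul Ω Ω' hF.1 hF'.1]
  rw [lintegral_congr h5]
  refine h4.trans (le_of_eq ?_)
  rw [ENNReal.mul_rpow_of_nonneg _ _ hs0.le, ENNReal.mul_rpow_of_nonneg _ _ hs0.le, hM,
    ← ENNReal.rpow_mul, one_div_mul_cancel hs0.ne', ENNReal.rpow_one]
  rw [hp_pow_rpow]
  ring


lemma hp_amgm (a b c d : ℝ≥0∞) : a * b * c * d ≤ a ^ 4 + b ^ 4 + c ^ 4 + d ^ 4 := by
  set M := max (max a b) (max c d) with hM
  have ha : a ≤ M := (le_max_left a b).trans (le_max_left _ _)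
  have hb : b ≤ M := (le_max_right a b).trans (le_max_left _ _)
  have hc : c ≤ M := (le_max_left c d).trans (le_max_right _ _)
  have hd : d ≤ M := (le_max_right c d).trans (le_max_right _ _)
  have h1 : a * b * c * d ≤ M ^ 4 := by
    calc a * b * c * d ≤ M * M * M * M := by gcongr
      _ = M ^ 4 := by ring
  refine h1.trans ?_
  have h2 : M = a ∨ M = b ∨ M = c ∨ M = d := by
    rcases max_choice (max a b) (max c d) with h | h <;> rcases max_choice a b with h' | h' <;>
      rcases max_choice c d with h'' | h'' <;> rw [hM, h] <;> simp [h', h'']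
  rcases h2 with h | h | h | h <;> rw [h]
  · rw [add_assoc, add_assoc]; exact le_self_add
  · rw [add_comm (a ^ 4), add_assoc, add_assoc]; exact le_self_add
  · rw [add_comm _ (c ^ 4), add_assoc]; exact le_self_add
  · exact le_add_self

lemma hp_quad (T : Finset ℤ) (A : ℤ → ℝ≥0∞) (w : ℤ → ℤ → ℝ≥0∞) (S : ℝ≥0∞)
    (hS : ∀ i, ∑ j ∈ T, w i j ≤ S) :
    ∑ i ∈ T, ∑ j ∈ T, ∑ k ∈ T, ∑ l ∈ T, A i * (w i j * w i k * w i l) ≤ S ^ 3 * ∑ i ∈ T, A i := by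
  rw [Finset.mul_sum]
  refine Finset.sum_le_sum fun i _ => ?_
  have : ∑ j ∈ T, ∑ k ∈ T, ∑ l ∈ T, A i * (w i j * w i k * w i l) =
      A i * ((∑ l ∈ T, w i l) * (∑ l ∈ T, w i l) * (∑ l ∈ T, w i l)) := by
    simp only [← Finset.mul_sum]
    simp only [← Finset.sum_mul]
    simp only [← Finset.mul_sum]
    simp only [← Finset.sum_mul]
  calc _ = A i * ((∑ l ∈ T, w i l) * (∑ l ∈ T, w i l) * (∑ l ∈ T, w i l)) := this
    _ ≤ A i * (S * S * S) := by gcongr <;> exact hS i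
    _ = _ := by ring

lemma hp_quad4 (T : Finset ℤ) (A : ℤ → ℝ≥0∞) (w : ℤ → ℤ → ℝ≥0∞) (S : ℝ≥0∞)
    (hS : ∀ i, ∑ j ∈ T, w i j ≤ S) :
    ∑ i ∈ T, ∑ j ∈ T, ∑ k ∈ T, ∑ l ∈ T, (A i * (w i j * w i k * w i l) +
      A j * (w j i * w j k * w j l) + A k * (w k i * w k j * w k l) + A l * (w l i * w l j * w l k))
      ≤ 4 * (S ^ 3 * ∑ i ∈ T, A i) := by
  have hq := hp_quad T A w S hS
  simp_rw [Finset.sum_add_distrib]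
  have h2 : ∑ i ∈ T, ∑ j ∈ T, ∑ k ∈ T, ∑ l ∈ T, A j * (w j i * w j k * w j l) ≤
      S ^ 3 * ∑ i ∈ T, A i := by
    rw [Finset.sum_comm]; exact hq
  have h3 : ∑ i ∈ T, ∑ j ∈ T, ∑ k ∈ T, ∑ l ∈ T, A k * (w k i * w k j * w k l) ≤
      S ^ 3 * ∑ i ∈ T, A i := by
    calc _ = ∑ i ∈ T, ∑ k ∈ T, ∑ j ∈ T, ∑ l ∈ T, A k * (w k i * w k j * w k l) :=
          Finset.sum_congr rfl fun i _ => Finset.sum_comm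
      _ ≤ _ := by rw [Finset.sum_comm]; exact hq
  have h4 : ∑ i ∈ T, ∑ j ∈ T, ∑ k ∈ T, ∑ l ∈ T, A l * (w l i * w l j * w l k) ≤
      S ^ 3 * ∑ i ∈ T, A i := by
    calc _ = ∑ i ∈ T, ∑ j ∈ T, ∑ l ∈ T, ∑ k ∈ T, A l * (w l i * w l j * w l k) :=
          Finset.sum_congr rfl fun i _ => Finset.sum_congr rfl fun j _ => Finset.sum_comm
      _ = ∑ i ∈ T, ∑ l ∈ T, ∑ j ∈ T, ∑ k ∈ T, A l * (w l i * w l j * w l k) :=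
          Finset.sum_congr rfl fun i _ => Finset.sum_comm
      _ ≤ _ := by rw [Finset.sum_comm]; exact hq
  calc _ ≤ S ^ 3 * ∑ i ∈ T, A i + S ^ 3 * ∑ i ∈ T, A i + S ^ 3 * ∑ i ∈ T, A i +
        S ^ 3 * ∑ i ∈ T, A i := by gcongr
    _ = _ := by ring

lemma hp_cs4 {E : Type*} [MeasurableSpace E] (μ : Measure E) (g1 g2 g3 g4 : E → ℝ≥0∞)
    (h1 : Measurable g1) (h2 : Measurable g2) (h3 : Measurable g3) (h4 : Measurable g4) :
    ∫⁻ p, g1 p * g2 p * g3 p * g4 p ∂μ ≤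
      (∫⁻ p, (g1 p * g2 p) ^ (2 : ℝ) ∂μ) ^ (1 / 2 : ℝ) * (∫⁻ p, (g3 p * g4 p) ^ (2 : ℝ) ∂μ) ^ (1 / 2 : ℝ) := by
  have := ENNReal.lintegral_mul_le_Lp_mul_Lq μ Real.HolderConjugate.two_two
    (h1.mul h2).aemeasurable (h3.mul h4).aemeasurable
  simp only [Pi.mul_apply] at this
  refine le_trans (le_of_eq ?_) this
  congr 1; ext p; ring

lemma hp_sum_rpow (T : Finset ℤ) (A : ℤ → ℝ≥0∞) (t : ℝ) (ht : 1 ≤ t) :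
    ∑ i ∈ T, A i ^ t ≤ (∑ i ∈ T, A i) ^ t := by
  have ht0 : 0 < t := by linarith
  have h := hp_rpow_sum_le T (fun i => A i ^ t) (q := 1 / t) (by positivity) (by rw [div_le_one ht0]; exact ht)
  simp_rw [← ENNReal.rpow_mul, mul_one_div_cancel ht0.ne', ENNReal.rpow_one] at h
  have h2 := ENNReal.rpow_le_rpow h ht0.le
  rwa [← ENNReal.rpow_mul, one_div_mul_cancel ht0.ne', ENNReal.rpow_one] at h2

lemma hp_summation {E : Type*} [MeasurableSpace E] (ν : Measure E) {s : ℝ} (hs1 : 3 / 2 < s) (hs2 : s < 2)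
    (B ρ : ℝ≥0∞) (hB : B ≠ ⊤) (hρ : ρ < 1) :
    ∃ C : ℝ≥0∞, C ≠ ⊤ ∧ ∀ (T : Finset ℤ) (F : ℤ → E → ℝ≥0∞) (α : ℤ → ℝ≥0∞), (∀ i, Measurable (F i)) →
      (∀ i ∈ T, ∀ j ∈ T, ∫⁻ p, (F i p * F j p) ^ s ∂ν ≤ B * (α i * α j) ^ (s - 1) * ρ ^ (i - j).natAbs) →
      ∫⁻ p, (∑ i ∈ T, F i p) ^ (2 * s) ∂ν ≤ C * (∑ i ∈ T, α i) ^ (2 * (s - 1)) := by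
  set τ := ρ ^ (1 / 8 : ℝ) with hτ
  have hτ1 : τ < 1 := ENNReal.rpow_lt_one hρ (by norm_num)
  set S := ∑' j : ℤ, τ ^ j.natAbs with hS
  have hSt : S ≠ ⊤ := hp_tsum_geo hτ1
  refine ⟨B * (4 * S ^ 3), ENNReal.mul_ne_top hB (ENNReal.mul_ne_top (by norm_num) (ENNReal.pow_ne_top hSt)), ?_⟩
  intro T F α hF hb
  set w : ℤ → ℤ → ℝ≥0∞ := fun i j => τ ^ (i - j).natAbs with hw
  have hwS : ∀ i, ∑ j ∈ T, w i j ≤ S := by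
    intro i
    refine (ENNReal.sum_le_tsum T).trans (le_of_eq ?_)
    rw [hS, ← hp_tsum_shift τ (-i)]
    refine tsum_congr fun j => ?_
    simp only [hw]; congr 1; omega
  set G : ℤ → E → ℝ≥0∞ := fun i p => F i p ^ (s / 2) with hG
  have hGm : ∀ i, Measurable (G i) := fun i => (hF i).pow_const _
  set A : ℤ → ℝ≥0∞ := fun i => α i ^ ((s - 1) / 2) with hA
  have hpair : ∀ i ∈ T, ∀ j ∈ T, (∫⁻ p, (G i p * G j p) ^ (2 : ℝ) ∂ν) ^ (1 / 2 : ℝ) ≤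
      B ^ (1 / 2 : ℝ) * (A i * A j) * τ ^ (4 * (i - j).natAbs) := by
    intro i hi j hj
    have e1 : ∀ p, (G i p * G j p) ^ (2 : ℝ) = (F i p * F j p) ^ s := by
      intro p
      simp only [hG]
      rw [← ENNReal.mul_rpow_of_nonneg _ _ (by linarith), ← ENNReal.rpow_mul]
      congr 1; ring
    rw [lintegral_congr e1]
    refine (ENNReal.rpow_le_rpow (hb i hi j hj) (by norm_num)).trans (le_of_eq ?_)
    rw [ENNReal.mul_rpow_of_nonneg _ _ (by norm_num), ENNReal.mul_rpow_of_nonneg _ _ (by norm_num),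
      ← ENNReal.rpow_mul, hp_pow_rpow, pow_mul, hτ, ← ENNReal.rpow_natCast (ρ ^ (1 / 8 : ℝ)), ← ENNReal.rpow_mul]
    simp only [hA]
    rw [← ENNReal.mul_rpow_of_nonneg _ _ (by linarith)]
    norm_num
    rw [show (s - 1) * (1 / 2) = (s - 1) / 2 by ring]
  have hquad : ∀ i ∈ T, ∀ j ∈ T, ∀ k ∈ T, ∀ l ∈ T, ∫⁻ p, G i p * G j p * G k p * G l p ∂ν ≤
      B * (A i ^ 4 * (w i j * w i k * w i l) +
      A j ^ 4 * (w j i * w j k * w j l) + A k ^ 4 * (w k i * w k j * w k l) +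
      A l ^ 4 * (w l i * w l j * w l k)) := by
    intro i hi j hj k hk l hl
    have hB2 : B ^ (1 / 2 : ℝ) * B ^ (1 / 2 : ℝ) = B := by
      rw [← ENNReal.rpow_add_of_nonneg _ _ (by norm_num) (by norm_num)]; norm_num
    have q1 : ∫⁻ p, G i p * G j p * G k p * G l p ∂ν ≤
        B * (A i * A j * A k * A l) * τ ^ (4 * ((i - j).natAbs + (k - l).natAbs)) := by
      refine (hp_cs4 ν _ _ _ _ (hGm i) (hGm j) (hGm k) (hGm l)).trans
        ((mul_le_mul' (hpair i hi j hj) (hpair k hk l hl)).trans (le_of_eq ?_))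
      nth_rewrite 3 [← hB2]
      rw [mul_add, pow_add]; ring
    have q2 : ∫⁻ p, G i p * G j p * G k p * G l p ∂ν ≤
        B * (A i * A j * A k * A l) * τ ^ (4 * ((i - k).natAbs + (j - l).natAbs)) := by
      have : ∀ p, G i p * G j p * G k p * G l p = G i p * G k p * G j p * G l p := fun p => by ring
      rw [lintegral_congr this]
      refine (hp_cs4 ν _ _ _ _ (hGm i) (hGm k) (hGm j) (hGm l)).trans
        ((mul_le_mul' (hpair i hi k hk) (hpair j hj l hl)).trans (le_of_eq ?_))
      nth_rewrite 3 [← hB2]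
      rw [mul_add, pow_add]; ring
    obtain ⟨m, hm1, hm2, hm⟩ : ∃ m : ℕ, (i - j).natAbs + (k - l).natAbs ≤ m ∧
        (i - k).natAbs + (j - l).natAbs ≤ m ∧ ∫⁻ p, G i p * G j p * G k p * G l p ∂ν ≤
        B * (A i * A j * A k * A l) * τ ^ (4 * m) := by
      rcases le_total ((i - j).natAbs + (k - l).natAbs) ((i - k).natAbs + (j - l).natAbs) with h | h
      · exact ⟨_, h, le_rfl, q2⟩
      · exact ⟨_, le_rfl, h, q1⟩
    refine hm.trans ?_
    rw [mul_assoc]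
    refine mul_le_mul_right ?_ B
    refine (mul_le_mul_left (hp_amgm _ _ _ _) _).trans ?_
    rw [add_mul, add_mul, add_mul]
    have hp : ∀ n, n ≤ 4 * m → τ ^ (4 * m) ≤ τ ^ n := fun n hn => pow_le_pow_of_le_one zero_le hτ1.le hn
    simp only [hw, ← pow_add]
    gcongr ?_ + ?_ + ?_ + ?_
    all_goals
      refine mul_le_mul_right (hp _ ?_) _
      omega
  calc ∫⁻ p, (∑ i ∈ T, F i p) ^ (2 * s) ∂ν ≤ ∫⁻ p, ∑ i ∈ T, ∑ j ∈ T, ∑ k ∈ T, ∑ l ∈ T,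
        G i p * G j p * G k p * G l p ∂ν := by
        refine lintegral_mono fun p => ?_
        have h1 := hp_rpow_sum_le T (fun i => F i p) (q := s / 2) (by linarith) (by linarith)
        calc (∑ i ∈ T, F i p) ^ (2 * s) = ((∑ i ∈ T, F i p) ^ (s / 2)) ^ (4 : ℕ) := by
              rw [← ENNReal.rpow_natCast, ← ENNReal.rpow_mul]; congr 1; push_cast; ring
          _ ≤ (∑ i ∈ T, G i p) ^ 4 := by gcongr
          _ = _ := by
              simp only [← Finset.mul_sum]
              simp only [← Finset.sum_mul]
              simp only [← Finset.mul_sum]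
              simp only [← Finset.sum_mul]
              simp only [← Finset.mul_sum]
              simp only [← Finset.sum_mul]
              ring
    _ = ∑ i ∈ T, ∑ j ∈ T, ∑ k ∈ T, ∑ l ∈ T, ∫⁻ p, G i p * G j p * G k p * G l p ∂ν := by
        rw [lintegral_finsetSum _ (fun i _ => by fun_prop)]
        refine Finset.sum_congr rfl fun i _ => ?_
        rw [lintegral_finsetSum _ (fun i _ => by fun_prop)]
        refine Finset.sum_congr rfl fun i _ => ?_
        rw [lintegral_finsetSum _ (fun i _ => by fun_prop)]
        refine Finset.sum_congr rfl fun i _ => ?_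
        rw [lintegral_finsetSum _ (fun i _ => by fun_prop)]
    _ ≤ ∑ i ∈ T, ∑ j ∈ T, ∑ k ∈ T, ∑ l ∈ T, B * (A i ^ 4 * (w i j * w i k * w i l) +
      A j ^ 4 * (w j i * w j k * w j l) + A k ^ 4 * (w k i * w k j * w k l) +
      A l ^ 4 * (w l i * w l j * w l k)) :=
        Finset.sum_le_sum fun i hi => Finset.sum_le_sum fun j hj => Finset.sum_le_sum fun k hk =>
          Finset.sum_le_sum fun l hl => hquad i hi j hj k hk l hl
    _ ≤ B * (4 * (S ^ 3 * ∑ i ∈ T, A i ^ 4)) := by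
        simp_rw [← Finset.mul_sum]
        exact mul_le_mul_right (hp_quad4 T (fun i => A i ^ 4) w S hwS) B
    _ ≤ B * (4 * (S ^ 3 * (∑ i ∈ T, α i) ^ (2 * (s - 1)))) := by
        gcongr
        have e : ∀ i, A i ^ 4 = α i ^ (2 * (s - 1)) := by
          intro i
          simp only [hA]
          rw [← ENNReal.rpow_natCast, ← ENNReal.rpow_mul]; congr 1; push_cast; ring
        simp_rw [e]
        exact hp_sum_rpow T α _ (by linarith)
    _ = _ := by ring


lemma hp_fatou {ι : Type*} {l : Filter ι} [l.NeBot] [l.IsCountablyGenerated] {t : ℝ} {C : ℝ≥0∞}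
    (F : ι → ℝ × ℝ × ℝ → ℂ) (hF : ∀ n, Measurable (F n)) (G : ℝ × ℝ × ℝ → ℂ)
    (hG : ∀ p, Filter.Tendsto (fun n => F n p) l (nhds (G p)))
    (hb : ∀ n, ∫⁻ p, ‖F n p‖ₑ ^ t ≤ C) : ∫⁻ p, ‖G p‖ₑ ^ t ≤ C := by
  have hlim : ∀ p, ‖G p‖ₑ ^ t = Filter.liminf (fun n => ‖F n p‖ₑ ^ t) l := by
    intro p
    exact ((hG p).enorm.ennrpow_const t).liminf_eq.symm
  rw [lintegral_congr hlim]
  refine (lintegral_liminf_le' (fun S => ((hF S).enorm.pow_const t).aemeasurable)).trans ?_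
  exact Filter.liminf_le_of_le (by isBoundedDefault) (fun b hb' => by
        obtain ⟨S, hS⟩ := hb'.exists
        exact hS.trans (hb S))

noncomputable def hpSl (Ω : Set (ℝ × ℝ)) (x : ℝ) : ℝ≥0∞ := volume (Prod.mk x ⁻¹' Ω)

lemma hpSl_meas {Ω : Set (ℝ × ℝ)} (hΩ : MeasurableSet Ω) : Measurable (hpSl Ω) :=
  measurable_measure_prodMk_left hΩ

def hpE (Ω : Set (ℝ × ℝ)) (K : ℤ) : Set ℝ :=
  {x | ENNReal.ofReal ((2 : ℝ) ^ (K - 1)) ≤ hpSl Ω x ∧ hpSl Ω x < ENNReal.ofReal ((2 : ℝ) ^ K)}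

lemma hpE_meas {Ω : Set (ℝ × ℝ)} (hΩ : MeasurableSet Ω) (K : ℤ) : MeasurableSet (hpE Ω K) :=
  (measurableSet_le measurable_const (hpSl_meas hΩ)).inter
    (measurableSet_lt (hpSl_meas hΩ) measurable_const)

def hpL (Ω : Set (ℝ × ℝ)) (K : ℤ) : Set (ℝ × ℝ) := Ω ∩ Prod.fst ⁻¹' hpE Ω K

lemma hpL_meas {Ω : Set (ℝ × ℝ)} (hΩ : MeasurableSet Ω) (K : ℤ) : MeasurableSet (hpL Ω K) :=
  hΩ.inter (measurable_fst (hpE_meas hΩ K))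

lemma hp_interval {a : ℝ} (ha : 0 < a) (m : ℤ) : volume {x : ℝ | ⌊a⁻¹ * x⌋ = m} = ENNReal.ofReal a := by
  have : {x : ℝ | ⌊a⁻¹ * x⌋ = m} = Ico (a * m) (a * m + a) := by
    ext x
    simp only [mem_ofPred_eq, mem_Ico, Int.floor_eq_iff]
    rw [le_inv_mul_iff₀ ha, inv_mul_lt_iff₀ ha, mul_add, mul_one]
  rw [this, Real.volume_Ico]; congr 1; ring

lemma hpL_fib {Ω : Set (ℝ × ℝ)} (hΩ : MeasurableSet Ω) {N : ℝ} (hN : Ω ⊆ Icc (-N) N ×ˢ Icc (-N) N)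
    (hf : volume Ω ≠ ⊤) (K : ℤ) (h0 : volume (hpL Ω K) ≠ 0) : ∃ μ : ℤ, hpFib (hpL Ω K) μ K := by
  have hLm := hpL_meas hΩ K
  have hLf : volume (hpL Ω K) ≠ ⊤ := ne_top_of_le_ne_top hf (measure_mono inter_subset_left)
  have hk1 : (0 : ℝ) < 2 ^ (K - 1) := by positivity
  have hsec : ∀ x, Prod.mk x ⁻¹' (hpL Ω K) ⊆ Prod.mk x ⁻¹' Ω := fun x => preimage_mono inter_subset_left
  have hsec0 : ∀ x, x ∉ hpE Ω K → Prod.mk x ⁻¹' (hpL Ω K) = ∅ := by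
    intro x hx
    ext y
    simp [hpL, hx]
  have hsec1 : ∀ x, x ∈ hpE Ω K → Prod.mk x ⁻¹' (hpL Ω K) = Prod.mk x ⁻¹' Ω := by
    intro x hx
    ext y
    simp [hpL, hx]
  have hvol : volume (hpL Ω K) = ∫⁻ x, volume (Prod.mk x ⁻¹' (hpL Ω K)) := by
    rw [Measure.volume_eq_prod, Measure.prod_apply hLm]
  have hlow : ENNReal.ofReal ((2 : ℝ) ^ (K - 1)) * volume (hpE Ω K) ≤ volume (hpL Ω K) := by
    rw [hvol, ← lintegral_indicator_const (hpE_meas hΩ K)]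
    refine lintegral_mono fun x => ?_
    by_cases hx : x ∈ hpE Ω K
    · rw [indicator_of_mem hx, hsec1 x hx]; exact hx.1
    · rw [indicator_of_notMem hx]; exact zero_le
  have hEf : volume (hpE Ω K) ≠ ⊤ := by
    intro h
    rw [h, ENNReal.mul_top (by simpa using hk1)] at hlow
    exact hLf (top_le_iff.1 hlow)
  have hE0 : volume (hpE Ω K) ≠ 0 := by
    intro h
    apply h0
    rw [hvol, lintegral_eq_zero_iff (measurable_measure_prodMk_left hLm)]
    have : ∀ᵐ x : ℝ, x ∉ hpE Ω K := measure_eq_zero_iff_ae_notMem.1 h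
    filter_upwards [this] with x hx
    rw [hsec0 x hx]; simp
  have hEr : 0 < (volume (hpE Ω K)).toReal := ENNReal.toReal_pos hE0 hEf
  obtain ⟨μ, hμ⟩ := exists_mem_Ico_zpow hEr (by norm_num : (1 : ℝ) < 2)
  have hEμ : volume (hpE Ω K) ≤ ENNReal.ofReal ((2 : ℝ) ^ (μ + 1)) := by
    rw [← ENNReal.ofReal_toReal hEf]; exact ENNReal.ofReal_le_ofReal hμ.2.le
  have hEμ' : ENNReal.ofReal ((2 : ℝ) ^ μ) ≤ volume (hpE Ω K) := by
    rw [← ENNReal.ofReal_toReal hEf]; exact ENNReal.ofReal_le_ofReal hμ.1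
  refine ⟨μ + 1, hLm, hLf, ⟨N, inter_subset_left.trans hN⟩, ?_, ?_⟩
  · intro a b ha hb m₁ m₂
    have hRm : MeasurableSet (hpL Ω K ∩ hpRect a b m₁ m₂) := hLm.inter (hpRect_meas _ _ _ _)
    set I := {x : ℝ | ⌊a⁻¹ * x⌋ = m₁} with hI
    have hIm : MeasurableSet I := by
      have h1 : Measurable fun z : ℝ => ⌊a⁻¹ * z⌋ := by fun_prop
      exact h1 (measurableSet_singleton m₁)
    have hmin : ∀ x y : ℝ, ENNReal.ofReal (min x y) = min (ENNReal.ofReal x) (ENNReal.ofReal y) :=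
      fun x y => ENNReal.ofReal_mono.map_min
    have h1 : volume (hpE Ω K ∩ I) ≤ ENNReal.ofReal (min ((2 : ℝ) ^ (μ + 1)) a) := by
      rw [hmin]
      refine le_min ((measure_mono inter_subset_left).trans hEμ) ((measure_mono inter_subset_right).trans ?_)
      rw [hI, hp_interval ha]
    rw [Measure.volume_eq_prod, Measure.prod_apply hRm]
    calc ∫⁻ x, volume (Prod.mk x ⁻¹' (hpL Ω K ∩ hpRect a b m₁ m₂)) ≤
        ∫⁻ x, (hpE Ω K ∩ I).indicator (fun _ => ENNReal.ofReal (min ((2 : ℝ) ^ K) b)) x := by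
          refine lintegral_mono fun x => ?_
          by_cases hx : x ∈ hpE Ω K ∩ I
          · rw [indicator_of_mem hx, hmin]
            refine le_min ?_ ?_
            · refine le_trans (measure_mono ?_) hx.1.2.le
              exact (preimage_mono inter_subset_left).trans (hsec x)
            · rw [← hp_interval hb m₂]
              refine measure_mono ?_
              intro y hy
              exact hy.2.2
          · rw [indicator_of_notMem hx]
            have : Prod.mk x ⁻¹' (hpL Ω K ∩ hpRect a b m₁ m₂) = ∅ := by
              ext y
              simp only [mem_preimage, mem_empty_iff_false, iff_false]
              intro hy
              exact hx ⟨hy.1.2, hy.2.1⟩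
            rw [this]; simp
      _ = ENNReal.ofReal (min ((2 : ℝ) ^ K) b) * volume (hpE Ω K ∩ I) := by
          rw [lintegral_indicator_const ((hpE_meas hΩ K).inter hIm)]
      _ ≤ _ := by rw [mul_comm]; gcongr
  · calc ENNReal.ofReal ((2 : ℝ) ^ (μ + 1)) * ENNReal.ofReal ((2 : ℝ) ^ K) =
        4 * (ENNReal.ofReal ((2 : ℝ) ^ (K - 1)) * ENNReal.ofReal ((2 : ℝ) ^ μ)) := by
          rw [show (4 : ℝ≥0∞) = ENNReal.ofReal 4 by norm_num, ← ENNReal.ofReal_mul (by positivity),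
            ← ENNReal.ofReal_mul (by positivity), ← ENNReal.ofReal_mul (by norm_num)]
          congr 1
          rw [zpow_add_one₀ (by norm_num), zpow_sub_one₀ (by norm_num)]; ring
      _ ≤ 4 * (ENNReal.ofReal ((2 : ℝ) ^ (K - 1)) * volume (hpE Ω K)) := by gcongr
      _ ≤ _ := by gcongr

lemma hpE_disj (Ω : Set (ℝ × ℝ)) {i j : ℤ} (hij : i < j) (x : ℝ) (h1 : x ∈ hpE Ω i) (h2 : x ∈ hpE Ω j) :
    False := by
  have h3 := h2.1.trans_lt h1.2
  have h4 : (2 : ℝ) ^ i ≤ 2 ^ (j - 1) := zpow_le_zpow_right₀ (by norm_num) (by omega)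
  exact absurd h3 (not_lt.2 (ENNReal.ofReal_le_ofReal h4))

lemma hpL_disj (Ω : Set (ℝ × ℝ)) : Pairwise (Function.onFun Disjoint (hpL Ω)) := by
  intro i j hij
  rw [Function.onFun, Set.disjoint_left]
  intro z hz hz'
  rcases lt_or_gt_of_ne hij with h | h
  · exact hpE_disj Ω h _ hz.2 hz'.2
  · exact hpE_disj Ω h _ hz'.2 hz.2

lemma hpL_union {Ω : Set (ℝ × ℝ)} (hΩ : MeasurableSet Ω) {N : ℝ} (hN : Ω ⊆ Icc (-N) N ×ˢ Icc (-N) N) :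
    ∀ᵐ z : ℝ × ℝ, z ∈ Ω → z ∈ ⋃ K, hpL Ω K := by
  have hfin : ∀ x, hpSl Ω x ≠ ⊤ := by
    intro x
    have : Prod.mk x ⁻¹' Ω ⊆ Icc (-N) N := fun y hy => (hN hy).2
    exact ne_top_of_le_ne_top (by simp) (measure_mono this)
  have h0 : volume (Ω ∩ Prod.fst ⁻¹' {x | hpSl Ω x = 0}) = 0 := by
    have hm : MeasurableSet (Ω ∩ Prod.fst ⁻¹' {x | hpSl Ω x = 0}) :=
      hΩ.inter (measurable_fst ((hpSl_meas hΩ) (measurableSet_singleton 0)))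
    rw [Measure.volume_eq_prod, Measure.prod_apply hm, lintegral_eq_zero_iff (measurable_measure_prodMk_left hm)]
    refine ae_of_all _ fun x => ?_
    by_cases hx : hpSl Ω x = 0
    · exact measure_mono_null (preimage_mono inter_subset_left) hx
    · have : Prod.mk x ⁻¹' (Ω ∩ Prod.fst ⁻¹' {x | hpSl Ω x = 0}) = ∅ := by
        ext y; simp [hx]
      simp only [this]; simp
  filter_upwards [measure_eq_zero_iff_ae_notMem.1 h0] with z hz hzΩ
  have hne : hpSl Ω z.1 ≠ 0 := fun h => hz ⟨hzΩ, h⟩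
  obtain ⟨K, hK⟩ := exists_mem_Ico_zpow (ENNReal.toReal_pos hne (hfin z.1)) (by norm_num : (1 : ℝ) < 2)
  refine mem_iUnion.2 ⟨K + 1, hzΩ, ?_, ?_⟩
  · rw [← ENNReal.ofReal_toReal (hfin z.1)]
    exact ENNReal.ofReal_le_ofReal (by simpa using hK.1)
  · rw [← ENNReal.ofReal_toReal (hfin z.1)]
    exact (ENNReal.ofReal_lt_ofReal_iff (by positivity)).2 hK.2

lemma hpPh_intOn (Ω : Set (ℝ × ℝ)) (hf : volume Ω ≠ ⊤) (p : ℝ × ℝ × ℝ) :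
    IntegrableOn (hpPh p) Ω := by
  have : IsFiniteMeasure (volume.restrict Ω) := ⟨by simpa using hf.lt_top⟩
  have hm := hpPh_meas1 p
  refine Integrable.of_bound (C := 1) (by fun_prop) (Filter.Eventually.of_forall fun z => ?_)
  rw [hpPh_norm]

lemma hpL_hasSum {Ω : Set (ℝ × ℝ)} (hΩ : MeasurableSet Ω) {N : ℝ} (hN : Ω ⊆ Icc (-N) N ×ˢ Icc (-N) N)
    (hf : volume Ω ≠ ⊤) (p : ℝ × ℝ × ℝ) :
    HasSum (fun K => extOp (chi (hpL Ω K)) p) (extOp (chi Ω) p) := by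
  have heq : ∫ ξ in Ω, hpPh p ξ = ∫ ξ in ⋃ K, hpL Ω K, hpPh p ξ := by
    apply setIntegral_congr_set
    filter_upwards [hpL_union hΩ hN] with z hz
    apply propext
    refine ⟨fun h => hz h, fun h => ?_⟩
    obtain ⟨K, hK⟩ := mem_iUnion.1 h
    exact hK.1
  rw [hp_ext Ω hΩ, heq]
  simp_rw [hp_ext _ (hpL_meas hΩ _)]
  apply hasSum_integral_iUnion
  · exact hpL_meas hΩ
  · exact hpL_disj Ω
  · exact (hpPh_intOn Ω hf p).mono_set (iUnion_subset fun n => inter_subset_left)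

lemma hp_bdd {s r A r0 : ℝ} (hs1 : 3 / 2 < s) (hs2 : s < 2) (hr0 : 0 < r0) (hr : r < r0)
    (hsr : s - 1 < s / r0) (hBH : BH s r A) :
    ∃ C : ℝ≥0∞, C ≠ ⊤ ∧ ∀ (Ω : Set (ℝ × ℝ)) (N : ℝ), MeasurableSet Ω → volume Ω ≠ ⊤ →
      Ω ⊆ Icc (-N) N ×ˢ Icc (-N) N →
      ∫⁻ p, ‖extOp (chi Ω) p‖ₑ ^ (2 * s) ≤ C * volume Ω ^ (2 * (s - 1)) := by
  obtain ⟨B, ρ, hB, hρ, hL⟩ := hp_fib hs1 hs2 hr0 hr hsr hBH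
  obtain ⟨C, hC, hS⟩ := hp_summation (volume : Measure (ℝ × ℝ × ℝ)) hs1 hs2 B ρ hB hρ
  refine ⟨C, hC, ?_⟩
  intro Ω N hΩ hf hN
  have hm : ∀ K, Measurable (extOp (chi (hpL Ω K))) := fun K => hp_ext_meas _ (hpL_meas hΩ K)
  refine hp_fatou (l := Filter.atTop) (fun (T : Finset ℤ) p => ∑ K ∈ T, extOp (chi (hpL Ω K)) p)
    (fun T => Finset.measurable_sum T fun i _ => hm i) _ (fun p => hpL_hasSum hΩ hN hf p) ?_
  intro T
  have h1 := hS T (fun K p => ‖extOp (chi (hpL Ω K)) p‖ₑ) (fun K => volume (hpL Ω K))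
    (fun K => (hm K).enorm) (by
      intro i _ j _
      have e : ∀ p, (‖extOp (chi (hpL Ω i)) p‖ₑ * ‖extOp (chi (hpL Ω j)) p‖ₑ) ^ s =
          ‖extOp (chi (hpL Ω i)) p * extOp (chi (hpL Ω j)) p‖ₑ ^ s := by
        intro p; rw [enorm_mul]
      have hz : ∀ K, volume (hpL Ω K) = 0 → ∀ p, extOp (chi (hpL Ω K)) p = 0 := by
        intro K hK p
        rw [hp_ext _ (hpL_meas hΩ K), setIntegral_measure_zero _ hK]
      rw [lintegral_congr e]
      by_cases hi : volume (hpL Ω i) = 0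
      · have : ∀ p, ‖extOp (chi (hpL Ω i)) p * extOp (chi (hpL Ω j)) p‖ₑ ^ s = 0 := by
          intro p; rw [hz i hi]; simp; linarith
        rw [lintegral_congr this]; simp
      by_cases hj : volume (hpL Ω j) = 0
      · have : ∀ p, ‖extOp (chi (hpL Ω i)) p * extOp (chi (hpL Ω j)) p‖ₑ ^ s = 0 := by
          intro p; rw [hz j hj]; simp; linarith
        rw [lintegral_congr this]; simp
      obtain ⟨μ, hμ⟩ := hpL_fib hΩ hN hf i hi
      obtain ⟨μ', hμ'⟩ := hpL_fib hΩ hN hf j hj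
      exact hL _ _ _ _ _ _ hμ hμ')
  refine le_trans (lintegral_mono fun p => ?_) (h1.trans ?_)
  · exact ENNReal.rpow_le_rpow (enorm_sum_le _ _) (by linarith)
  · gcongr
    · linarith
    rw [← measure_biUnion_finset (fun i _ j _ h => hpL_disj Ω h) (fun i _ => hpL_meas hΩ i)]
    exact measure_mono (iUnion₂_subset fun i _ => inter_subset_left)

lemma hp_all {s r A r0 : ℝ} (hs1 : 3 / 2 < s) (hs2 : s < 2) (hr0 : 0 < r0) (hr : r < r0)
    (hsr : s - 1 < s / r0) (hBH : BH s r A) :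
    ∃ C : ℝ≥0∞, C ≠ ⊤ ∧ ∀ (Ω : Set (ℝ × ℝ)), MeasurableSet Ω → volume Ω ≠ ⊤ →
      ∫⁻ p, ‖extOp (chi Ω) p‖ₑ ^ (2 * s) ≤ C * volume Ω ^ (2 * (s - 1)) := by
  obtain ⟨C, hC, hL⟩ := hp_bdd hs1 hs2 hr0 hr hsr hBH
  refine ⟨C, hC, fun Ω hΩ hf => ?_⟩
  set Q : ℕ → Set (ℝ × ℝ) := fun n => Icc (-(n : ℝ)) n ×ˢ Icc (-(n : ℝ)) n with hQ
  have hQm : ∀ n, MeasurableSet (Q n) := fun n => measurableSet_Icc.prod measurableSet_Icc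
  have hmono : Monotone fun n => Ω ∩ Q n := by
    intro n m hnm
    have h : (n : ℝ) ≤ m := by exact_mod_cast hnm
    exact inter_subset_inter_right _ (prod_mono (Icc_subset_Icc (by linarith) h) (Icc_subset_Icc (by linarith) h))
  have hU : ⋃ n, Ω ∩ Q n = Ω := by
    rw [← inter_iUnion]
    refine inter_eq_left.2 fun z _ => ?_
    obtain ⟨n, hn⟩ := exists_nat_ge (max |z.1| |z.2|)
    refine mem_iUnion.2 ⟨n, ?_⟩
    have h1 := abs_le.1 ((le_max_left _ _).trans hn)
    have h2 := abs_le.1 ((le_max_right _ _).trans hn)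
    exact ⟨⟨h1.1, h1.2⟩, ⟨h2.1, h2.2⟩⟩
  refine hp_fatou (l := Filter.atTop) (fun n => extOp (chi (Ω ∩ Q n)))
    (fun n => hp_ext_meas _ (hΩ.inter (hQm n))) _ ?_ ?_
  · intro p
    have h := tendsto_setIntegral_of_monotone (μ := volume) (f := hpPh p) (fun n => hΩ.inter (hQm n)) hmono
      (by rw [hU]; exact hpPh_intOn Ω hf p)
    rw [hU] at h
    simp_rw [hp_ext _ (hΩ.inter (hQm _))]
    rw [hp_ext _ hΩ]
    exact h
  · intro n
    have hle : volume (Ω ∩ Q n) ≤ volume Ω := measure_mono inter_subset_left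
    refine (hL (Ω ∩ Q n) n (hΩ.inter (hQm n)) (ne_top_of_le_ne_top hf hle) inter_subset_right).trans ?_
    gcongr
    linarith

/-- if BH(s,r) holds for some `3/2 < s < 2` and `r < s' = s/(s-1)`, then `𝓔` is of
restricted strong type `(s', 2s)`: `∥𝓔χ_Ω∥_{L^{2s}} ≤ C|Ω|^{1/s'}` for every finite-measure
measurable `Ω ⊆ ℝ²`, with `C` depending only on `s, r, A`. -/
theorem stmt0 (s r A : ℝ) (hs₁ : 3 / 2 < s) (hs₂ : s < 2) (hr : r < s / (s - 1))
    (hBH : BH s r A) :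
    ∃ C : ℝ, 0 < C ∧
      ∀ Ω : Set (ℝ × ℝ), MeasurableSet Ω → volume Ω < ⊤ →
        eLpNorm (extOp (chi Ω)) (ENNReal.ofReal (2 * s)) volume ≤
          ENNReal.ofReal C * volume Ω ^ (1 - 1 / s) := by
  have hs0 : 0 < s := by linarith
  have hs1 : 0 < s - 1 := by linarith
  have hq : 1 < s / (s - 1) := by rw [lt_div_iff₀ hs1]; linarith
  set r0 := max ((r + s / (s - 1)) / 2) 1 with hr0
  have hr0p : 0 < r0 := lt_of_lt_of_le one_pos (le_max_right _ _)
  have hrr : r < r0 := lt_of_lt_of_le (by linarith) (le_max_left _ _)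
  have hrs : r0 < s / (s - 1) := max_lt (by linarith) hq
  have hsr : s - 1 < s / r0 := by
    rw [lt_div_iff₀ hr0p]; rw [lt_div_iff₀ hs1] at hrs; linarith
  obtain ⟨C, hC, hL⟩ := hp_all hs₁ hs₂ hr0p hrr hsr hBH
  refine ⟨(C ^ (1 / (2 * s))).toReal + 1, by positivity, fun Ω hΩ hf => ?_⟩
  have hCt : C ^ (1 / (2 * s)) ≠ ⊤ := ENNReal.rpow_ne_top_of_nonneg (by positivity) hC
  rw [eLpNorm_eq_lintegral_rpow_enorm_toReal (by simpa using hs0) ENNReal.ofReal_ne_top,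
    ENNReal.toReal_ofReal (by linarith)]
  refine (ENNReal.rpow_le_rpow (hL Ω hΩ hf.ne) (by positivity)).trans ?_
  rw [ENNReal.mul_rpow_of_nonneg _ _ (by positivity), ← ENNReal.rpow_mul]
  have e : 2 * (s - 1) * (1 / (2 * s)) = 1 - 1 / s := by field_simp
  rw [e]
  gcongr
  rw [← ENNReal.ofReal_toReal hCt]
  exact ENNReal.ofReal_le_ofReal (by simp)
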